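/- arXiv:1903.07310 — 6 statements merged into one kernel-verified Lean document; each statement's English description precedes it below -/
import Mathlib

section
/- Let L be an elementary abelian 2-group of order 2^{2a+b} where a is a nonnegative integer and b ∈ {0,1}, identified with {0,1}^c where c = 2a+b, with componentwise addition modulo 2. Define s_L : L → ℤ by s_L(g) = 2·∑_{i=1}^{a} g_i g_{a+i} if b = 0, and s_L(g) = 2·∑_{i=1}^{a} g_i g_{a+i} + g_c if b = 1 (here the sums are sums of integers). For x, y ∈ L let x ⊕ y denote the componentwise sum modulo 2 (taking values in {0,1}). Then for every nonzero g ∈ L, ∑_{x ∈ L} i^{s_L(x) − s_L(x ⊕ g)} = 0, where i = ζ_4 is a primitive fourth root of unity in ℂ. -/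
open scoped BigOperators

theorem Complex.I_zpow_eq_neg_of_emod {m n : ℤ} (h : (m - n) % 4 = 2) :
    Complex.I ^ m = -Complex.I ^ n := by
  obtain ⟨k, hk⟩ : ∃ k, m = n + 2 + 4 * k := ⟨(m - n) / 4, by omega⟩
  have h4 : Complex.I ^ (4 : ℤ) = 1 := by
    exact_mod_cast Complex.I_pow_four
  have h2 : Complex.I ^ (2 : ℤ) = -1 := by
    exact_mod_cast Complex.I_sq
  rw [hk, zpow_add₀ Complex.I_ne_zero, zpow_add₀ Complex.I_ne_zero, zpow_mul, h4, h2]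
  simp

/-- A sum of powers of `I` vanishes if some translation changes the exponent by `2` modulo `4`. -/
theorem sum_I_zpow_eq_zero_of_translate {A : Type*} [AddGroup A] [Fintype A] (D : A → ℤ) (v : A)
    (h : ∀ x, (D (x + v) - D x) % 4 = 2) : ∑ x, Complex.I ^ D x = 0 := by
  have h1 : ∑ x, Complex.I ^ D (x + v) = ∑ x, Complex.I ^ D x :=
    Equiv.sum_comp (Equiv.addRight v) fun x => Complex.I ^ D x
  simp_rw [fun x => Complex.I_zpow_eq_neg_of_emod (h x), Finset.sum_neg_distrib] at h1
  exact self_eq_neg.mp h1.symm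

theorem translate_hyperbolic_sum_sub {κ ι : Type*} [Fintype κ] [DecidableEq κ] [DecidableEq ι]
    (p q : κ → ι) (hq : Function.Injective q) (hpq : ∀ i j, p i ≠ q j)
    (r : (ι → ZMod 2) → ℤ) (s : (ι → ZMod 2) → ℤ)
    (hs : ∀ x, s x = 2 * ∑ i, ((x (p i)).val : ℤ) * ((x (q i)).val : ℤ) + r x)
    (j : κ) (hr : ∀ x, r (x + Pi.single (q j) 1) = r x)
    (g : ι → ZMod 2) (hg : g (p j) = 1) (x : ι → ZMod 2) :
    (s (x + Pi.single (q j) 1) - s (x + Pi.single (q j) 1 + g) - (s x - s (x + g))) % 4 = 2 := by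
  have hterm : ∀ y : ι → ZMod 2, s (y + Pi.single (q j) 1) - s y =
      2 * (((y (p j)).val : ℤ) * (((y (q j) + 1).val : ℤ) - ((y (q j)).val : ℤ))) := by
    intro y
    rw [hs, hs, hr, add_sub_add_right_eq_sub, ← mul_sub, ← Finset.sum_sub_distrib,
      Finset.sum_eq_single j]
    · simp [Pi.single_eq_of_ne (hpq j j), mul_sub]
    · intro i _ hij
      simp [Pi.single_eq_of_ne (hpq i j), Pi.single_eq_of_ne (hq.ne hij)]
    · simp
  have h1 := hterm x
  have h2 := hterm (x + g)
  have hval : ∀ u w h : ZMod 2,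
      (2 * ((u.val : ℤ) * (((w + 1).val : ℤ) - (w.val : ℤ)))
        - 2 * (((u + 1).val : ℤ) * (((w + h + 1).val : ℤ) - ((w + h).val : ℤ)))) % 4 = 2 := by
    decide
  have h3 := hval (x (p j)) (x (q j)) (g (q j))
  rw [add_right_comm x (Pi.single (q j) 1) g]
  simp only [Pi.add_apply, hg] at h2
  rw [← h1, ← h2] at h3
  rw [← h3]
  congr 1
  ring

/-- Let `L` be the elementary abelian 2-group `{0,1}^c`, `c = 2a + b`
with `b ∈ {0,1}`, and let `s_L(g) = 2 ∑_{i<a} g_i g_{a+i} (+ g_c if b = 1)` (an integer).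
Then for every nonzero `g ∈ L`, `∑_{x ∈ L} i^(s_L(x) - s_L(x ⊕ g)) = 0`. -/
theorem statement0 (a b : ℕ) (hb : b = 0 ∨ b = 1)
    (sL : (Fin (2 * a + b) → ZMod 2) → ℤ)
    (hsL : ∀ g : Fin (2 * a + b) → ZMod 2,
      sL g = 2 * ∑ i : Fin a,
          ((g ⟨i.1, by omega⟩).val : ℤ) * ((g ⟨a + i.1, by omega⟩).val : ℤ)
        + (if h : b = 1 then ((g ⟨2 * a, by omega⟩).val : ℤ) else 0))
    (g : Fin (2 * a + b) → ZMod 2) (hg : g ≠ 0) :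
    ∑ x : Fin (2 * a + b) → ZMod 2, Complex.I ^ (sL x - sL (x + g)) = 0 := by
  have hone : ∀ z : ZMod 2, z ≠ 0 → z = 1 := by decide
  by_cases hlow : ∃ j : Fin a, g ⟨j.1, by omega⟩ ≠ 0
  · obtain ⟨j, hj⟩ := hlow
    have hinj : Function.Injective fun i : Fin a => (⟨a + i.1, by omega⟩ : Fin (2 * a + b)) := by
      intro i k h
      simpa [Fin.ext_iff] using h
    have hdisj : ∀ i k : Fin a, (⟨i.1, by omega⟩ : Fin (2 * a + b)) ≠ ⟨a + k.1, by omega⟩ := by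
      intro i k h
      simp only [Fin.mk.injEq] at h
      omega
    have key := translate_hyperbolic_sum_sub _ _ hinj hdisj
      (fun y => if h : b = 1 then ((y ⟨2 * a, by omega⟩).val : ℤ) else 0)
      sL hsL j (by
        intro y
        have hne : 2 * a ≠ a + j.1 := by omega
        simp [hne]) g (hone _ hj)
    exact sum_I_zpow_eq_zero_of_translate (fun x => sL x - sL (x + g)) _ key
  by_cases hhigh : ∃ j : Fin a, g ⟨a + j.1, by omega⟩ ≠ 0
  · obtain ⟨j, hj⟩ := hhigh
    have hinj : Function.Injective fun i : Fin a => (⟨i.1, by omega⟩ : Fin (2 * a + b)) := by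
      intro i k h
      simpa [Fin.ext_iff] using h
    have hdisj : ∀ i k : Fin a, (⟨a + i.1, by omega⟩ : Fin (2 * a + b)) ≠ ⟨k.1, by omega⟩ := by
      intro i k h
      simp only [Fin.mk.injEq] at h
      omega
    have key := translate_hyperbolic_sum_sub _ _ hinj hdisj
      (fun y => if h : b = 1 then ((y ⟨2 * a, by omega⟩).val : ℤ) else 0)
      sL (fun y => by rw [hsL]; simp only [mul_comm]) j (by
        intro y
        have hne : 2 * a ≠ j.1 := by omega
        simp [hne]) g (hone _ hj)
    exact sum_I_zpow_eq_zero_of_translate (fun x => sL x - sL (x + g)) _ key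
  push Not at hlow hhigh
  obtain ⟨k, hk⟩ := Function.ne_iff.mp hg
  have hka : 2 * a ≤ k.1 := by
    by_contra! hlt
    by_cases hk' : k.1 < a
    · exact hk (hlow ⟨k.1, hk'⟩)
    · refine hk (Eq.trans (congrArg g (Fin.ext ?_)) (hhigh ⟨k.1 - a, by omega⟩))
      simp only
      omega
  have hb1 : b = 1 := by omega
  subst hb1
  have hk1 : g ⟨2 * a, by omega⟩ = 1 := by
    rw [← hone _ hk]
    exact congrArg g (Fin.ext (by simp only; omega))
  have hD : ∀ x, sL x - sL (x + g) =
      ((x ⟨2 * a, by omega⟩).val : ℤ) - ((x ⟨2 * a, by omega⟩ + 1).val : ℤ) := by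
    intro x
    simp [hsL, hlow, hhigh, hk1]
  simp_rw [hD]
  refine sum_I_zpow_eq_zero_of_translate _ (Pi.single ⟨2 * a, by omega⟩ 1) fun x => ?_
  have hval : ∀ z : ZMod 2, (((z + 1).val : ℤ) - ((z + 1 + 1).val : ℤ)
      - ((z.val : ℤ) - ((z + 1).val : ℤ))) % 4 = 2 := by
    decide
  simpa only [Pi.add_apply, Pi.single_eq_same] using hval (x ⟨2 * a, by omega⟩)
end

section
/- Let K = G × L be a finite abelian group (written additively), where either L = {0} or L is an elementary abelian 2-group of order 2^{2a+b} with b ∈ {0,1}, identified with {0,1}^c, c = 2a+b; let s_L : L → ℤ be given by s_L(g) = 2·∑_{i=1}^{a} g_i g_{a+i} (plus g_c if b = 1), and for x,y ∈ L let x ⊕ y be the componentwise sum modulo 2. Write e = exp(G). Let U be a subgroup of G such that every element u of U has a square root in G (an element h ∈ G with 2h = u; fix a choice u ↦ u/2 of such square roots). Suppose f : G × G → ℤ_e is bilinear, symmetric and nondegenerate, and that no element of G \ U is orthogonal to all elements of U (i.e., if g ∈ G satisfies f(g,u) = 0 for all u ∈ U, then g ∈ U). Let R ⊂ G be a complete system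 of coset representatives of U in G with 0 ∈ R; for every x ∈ K write x = x_1 + x_2 + x_3 with unique x_1 ∈ U, x_2 ∈ R, x_3 ∈ L. Let β be an integer coprime to |G|. Define the K × K matrix H by H_{y,x} = ζ_e^{f((x−y)_1/2, (x−y)_1) + β·f((x−y)_1, (x−y)_2)} · ζ_4^{s_L(x_3 ⊕ y_3)}. Then H is a BH(K, e_1) matrix, where e_1 = exp(U) if L = {0}, e_1 = lcm(2, exp(U)) if |L| is a square, and e_1 = lcm(4, exp(U)) otherwise. -/
open scoped BigOperators

/-- `H` is a `BH(G, h)` matrix: a `G`-invariant matrix whose entries are complex `h`-th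
roots of unity and which satisfies `H * Hᴴ = |G| • I`. -/
def IsBHMatrix {G : Type} [AddCommGroup G] [Fintype G] [DecidableEq G]
    (H : Matrix G G ℂ) (h : ℕ) : Prop :=
  (∀ g k, H g k ^ h = 1) ∧
  (∀ g k l, H (g + l) (k + l) = H g k) ∧
  H * H.conjTranspose = (Fintype.card G : ℂ) • (1 : Matrix G G ℂ)
/-- A function on a finite abelian group all of whose nontrivial autocorrelations vanish and
whose trivial autocorrelation is the group order. -/
def HasPerfectAutocorrelation {A : Type*} [AddCommGroup A] [Fintype A] [DecidableEq A]
    (h : A → ℂ) : Prop :=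
  ∀ w, ∑ x, h x * star (h (x + w)) = if w = 0 then (Fintype.card A : ℂ) else 0

lemma HasPerfectAutocorrelation.prod {A B : Type*} [AddCommGroup A] [Fintype A] [DecidableEq A]
    [AddCommGroup B] [Fintype B] [DecidableEq B] {h : A → ℂ} {k : B → ℂ}
    (hh : HasPerfectAutocorrelation h) (hk : HasPerfectAutocorrelation k) :
    HasPerfectAutocorrelation (fun x : A × B => h x.1 * k x.2) := by
  rintro ⟨w, v⟩
  have key : ∑ x : A × B, h x.1 * k x.2 * star (h (x.1 + w) * k (x.2 + v)) =
      (∑ x, h x * star (h (x + w))) * ∑ x, k x * star (k (x + v)) := by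
    rw [Finset.sum_mul_sum, Fintype.sum_prod_type]
    refine Finset.sum_congr rfl fun x _ => Finset.sum_congr rfl fun y _ => ?_
    rw [star_mul']
    ring
  simp only [Prod.fst_add, Prod.snd_add, key, hh w, hk v, Prod.mk_eq_zero]
  by_cases h1 : w = 0 <;> by_cases h2 : v = 0 <;> simp [h1, h2]

lemma HasPerfectAutocorrelation.isBHMatrix {A : Type} [AddCommGroup A] [Fintype A] [DecidableEq A]
    {h : A → ℂ} (hh : HasPerfectAutocorrelation h) {n : ℕ} (hn : ∀ x, h x ^ n = 1)
    {H : Matrix A A ℂ} (hH : ∀ y x, H y x = h (x - y)) : IsBHMatrix H n := by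
  refine ⟨fun g k => by rw [hH, hn], fun g k l => by rw [hH, hH, add_sub_add_right_eq_sub], ?_⟩
  ext y z
  have key : (H * H.conjTranspose) y z = ∑ x, h x * star (h (x + (y - z))) := by
    rw [Matrix.mul_apply, ← Equiv.sum_comp (Equiv.addRight y)]
    refine Finset.sum_congr rfl fun x _ => ?_
    rw [Matrix.conjTranspose_apply, hH, hH, Equiv.coe_addRight, add_sub_cancel_right, add_sub_assoc]
  rw [key, hh, Matrix.smul_apply, Matrix.one_apply, smul_eq_mul, mul_ite, mul_one, mul_zero]
  simp only [sub_eq_zero]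

lemma sum_stdAddChar_eq_zero {A : Type*} [AddCommGroup A] [Fintype A] {n : ℕ} [NeZero n]
    {φ : A →+ ZMod n} (hφ : ∃ x, φ x ≠ 0) : ∑ x, ZMod.stdAddChar (φ x) = 0 := by
  obtain ⟨x, hx⟩ := hφ
  refine (AddChar.sum_eq_zero_iff_ne_zero (ψ := ZMod.stdAddChar.compAddMonoidHom φ)).2 fun h => hx ?_
  apply ZMod.injective_stdAddChar
  rw [AddChar.map_zero_eq_one]
  exact DFunLike.congr_fun h x

lemma sum_eq_zero_of_sum_coset_eq_zero {A : Type*} [AddCommGroup A] [Fintype A] (U : AddSubgroup A)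
    [Fintype U] {g : A → ℂ} (hg : ∀ x, ∑ u : U, g (x + u) = 0) : ∑ x, g x = 0 := by
  have h : ∑ u : U, ∑ x, g (x + u) = 0 := by
    rw [Finset.sum_comm]
    exact Finset.sum_eq_zero fun x _ => hg x
  have h2 : ∀ u : U, ∑ x, g (x + u) = ∑ x, g x := fun u =>
    Equiv.sum_comp (Equiv.addRight (u : A)) g
  simpa [h2] using h

section BilinearForm

variable {G : Type*} [AddCommGroup G] {n : ℕ} (B : G →+ G →+ ZMod n)

/-- On elements with square roots, `u ↦ B (u/2) u` is a quadratic form with polarization `B`. -/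
lemma half_form_add (hsym : ∀ g h, B g h = B h g) {U : AddSubgroup G} {σ : G → G}
    (hσ : ∀ u ∈ U, 2 • σ u = u) {u v : G} (hu : u ∈ U) (hv : v ∈ U) :
    B (σ (u + v)) (u + v) = B (σ u) u + B (σ v) v + B u v := by
  have huv := hσ _ (U.add_mem hu hv)
  have e1 : B (σ (u + v)) (u + v) = B (σ u + σ v) (u + v) := by
    have hdouble : ∀ g, B g (u + v) = B (2 • g) (σ (u + v)) := fun g => by
      conv_lhs => rw [← huv]
      rw [map_nsmul, map_nsmul, AddMonoidHom.nsmul_apply]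
    rw [hdouble, hdouble, nsmul_add, huv, hσ u hu, hσ v hv]
  have e2 : B (σ u) v = B (σ v) u := by
    conv_lhs => rw [← hσ v hv]
    conv_rhs => rw [← hσ u hu]
    rw [map_nsmul, map_nsmul, hsym]
  have e3 : B u v = B (σ v) u + B (σ v) u := by
    conv_lhs => rw [← hσ v hv]
    rw [map_nsmul, hsym, two_nsmul]
  rw [e1, e3]
  simp only [map_add, AddMonoidHom.add_apply, e2]
  abel

lemma AddSubgroup.mem_of_zsmul_mem_of_isCoprime [Fintype G] {U : AddSubgroup G} {β : ℤ}
    (hβ : IsCoprime β (Fintype.card G : ℤ)) {d : G} (hd : β • d ∈ U) : d ∈ U := by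
  obtain ⟨s, t, hst⟩ := hβ
  have : d = s • β • d := by
    conv_lhs => rw [← one_zsmul d, ← hst, add_zsmul, mul_zsmul, mul_zsmul, natCast_zsmul,
      card_nsmul_eq_zero, zsmul_zero, add_zero]
  rw [this]
  exact U.zsmul_mem hd s

/-- The exponent function `x ↦ B (x₁/2) x₁ + β B x₁ x₂` composed with the standard character
has perfect autocorrelation. -/
lemma hasPerfectAutocorrelation_halfForm [Fintype G] [DecidableEq G] [NeZero n]
    (hsym : ∀ g h, B g h = B h g) (hnd : ∀ g, (∀ x, B g x = 0) → g = 0)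
    {U : AddSubgroup G} {σ : G → G} (hσ : ∀ u ∈ U, 2 • σ u = u)
    (hU : ∀ g, (∀ u ∈ U, B g u = 0) → g ∈ U)
    {R : Set G} {p1 p2 : G → G} (hp1 : ∀ x, p1 x ∈ U) (hp2 : ∀ x, p2 x ∈ R)
    (hdecomp : ∀ x, x = p1 x + p2 x)
    (huniq : ∀ x : G, ∀ u ∈ U, ∀ r ∈ R, x = u + r → u = p1 x ∧ r = p2 x)
    {β : ℤ} (hβ : IsCoprime β (Fintype.card G : ℤ)) :
    HasPerfectAutocorrelation fun x =>
      (ZMod.stdAddChar (B (σ (p1 x)) (p1 x) + β • B (p1 x) (p2 x)) : ℂ) := by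
  classical
  obtain ⟨F, hF⟩ : ∃ F : G → ZMod n, ∀ x, F x = B (σ (p1 x)) (p1 x) + β • B (p1 x) (p2 x) :=
    ⟨_, fun _ => rfl⟩
  have hshift : ∀ x, ∀ u ∈ U, p1 x + u = p1 (x + u) ∧ p2 x = p2 (x + u) := fun x u hu =>
    huniq _ _ (U.add_mem (hp1 x) hu) _ (hp2 x) (by
      conv_lhs => rw [hdecomp x]
      abel)
  have hFadd : ∀ x, ∀ u ∈ U,
      F (x + u) = F x + B (σ u) u + B (p1 x) u + β • B (p2 x) u := by
    intro x u hu
    rw [hF, hF, ← (hshift x u hu).1, ← (hshift x u hu).2, half_form_add B hsym hσ (hp1 x) hu, map_add,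
      AddMonoidHom.add_apply, hsym u (p2 x), smul_add]
    abel
  have hcorr : ∀ x w, (ZMod.stdAddChar (F x) : ℂ) * star (ZMod.stdAddChar (F (x + w)) : ℂ) =
      ZMod.stdAddChar (F x - F (x + w)) := fun x w => by
    rw [sub_eq_add_neg, AddChar.map_add_eq_mul, AddChar.map_neg_eq_conj]
    rfl
  intro w
  simp only [← hF, hcorr]
  split_ifs with hw0
  · simp [hw0]
  by_cases hw : ∀ u ∈ U, B w u = 0
  · have hwU := hU w hw
    have hE : ∀ x, F x - F (x + w) = -B (σ w) w + (-β • B w) x := fun x => by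
      have h1 : B w x = B w (p2 x) := by
        conv_lhs => rw [hdecomp x, map_add, hw _ (hp1 x), zero_add]
      rw [hFadd x w hwU, hsym (p1 x), hw _ (hp1 x), hsym (p2 x), ← h1, AddMonoidHom.zsmul_apply,
        neg_zsmul]
      abel
    simp only [hE, AddChar.map_add_eq_mul, ← Finset.mul_sum]
    rw [sum_stdAddChar_eq_zero, mul_zero]
    by_contra! hcon
    refine hw0 ((AddSubgroup.mem_bot).1
      (AddSubgroup.mem_of_zsmul_mem_of_isCoprime (U := ⊥) hβ ?_))
    refine (AddSubgroup.mem_bot).2 (hnd _ fun x => ?_)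
    simpa using hcon x
  · refine sum_eq_zero_of_sum_coset_eq_zero U fun x => ?_
    set c := p1 x - p1 (x + w) + β • (p2 x - p2 (x + w)) with hc
    have hE : ∀ u : U, F (x + u) - F (x + u + w) =
        (F x - F (x + w)) + (B c).comp U.subtype u := fun u => by
      rw [add_right_comm x, hFadd x u u.2, hFadd (x + w) u u.2]
      simp only [hc, map_add, map_sub, map_zsmul, AddMonoidHom.add_apply, AddMonoidHom.sub_apply,
        AddMonoidHom.zsmul_apply, AddMonoidHom.comp_apply, AddSubgroup.subtype_apply, smul_sub]
      abel
    simp only [hE, AddChar.map_add_eq_mul, ← Finset.mul_sum]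
    rw [sum_stdAddChar_eq_zero, mul_zero]
    by_contra! hcon
    have hcon' : ∀ u ∈ U, B c u = 0 := fun u hu => hcon ⟨u, hu⟩
    have hd : p2 x - p2 (x + w) ∈ U := by
      refine AddSubgroup.mem_of_zsmul_mem_of_isCoprime hβ ?_
      have := U.sub_mem (hU c hcon') (U.sub_mem (hp1 x) (hp1 (x + w)))
      rwa [hc, add_sub_cancel_left] at this
    have hp : p2 x = p2 (x + w) := by
      rw [(huniq (p2 x) 0 U.zero_mem _ (hp2 x) (zero_add _).symm).2]
      exact (huniq (p2 x) _ hd _ (hp2 (x + w)) (sub_add_cancel _ _).symm).2.symm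
    have hcw : w = -c := by
      have h1 := hdecomp x
      have h2 := hdecomp (x + w)
      rw [hc, hp, sub_self, smul_zero, add_zero]
      rw [← hp] at h2
      calc w = (x + w) - x := by abel
        _ = (p1 (x + w) + p2 x) - (p1 x + p2 x) := by rw [← h2, ← h1]
        _ = _ := by abel
    refine hw fun u hu => ?_
    rw [hcw, map_neg, AddMonoidHom.neg_apply, hcon' u hu, neg_zero]

end BilinearForm

/-- The sign character of `ZMod 2`. -/
noncomputable def signChar (x : ZMod 2) : ℂ := (-1) ^ x.val

lemma ZMod.two_eq_zero_or_eq_one (x : ZMod 2) : x = 0 ∨ x = 1 := by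
  revert x
  decide

lemma signChar_add (x y : ZMod 2) : signChar (x + y) = signChar x * signChar y := by
  obtain rfl | rfl := x.two_eq_zero_or_eq_one <;> obtain rfl | rfl := y.two_eq_zero_or_eq_one <;>
    simp [signChar, ZMod.val_one, CharTwo.add_self_eq_zero]

section Binary

variable {a b : ℕ}

/-- The product form of `z ↦ i ^ s_L(z)`. -/
noncomputable def binaryPhase (a b : ℕ) (z : Fin (2 * a + b) → ZMod 2) : ℂ :=
  (∏ i : Fin a, signChar (z ⟨i.1, by omega⟩ * z ⟨a + i.1, by omega⟩)) *
    if h : b = 1 then Complex.I ^ (z ⟨2 * a, by omega⟩).val else 1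

lemma binaryPhase_eq (z : Fin (2 * a + b) → ZMod 2) :
    Complex.I ^ (2 * ∑ i : Fin a,
          ((z ⟨i.1, by omega⟩).val : ℤ) * ((z ⟨a + i.1, by omega⟩).val : ℤ)
        + (if h : b = 1 then ((z ⟨2 * a, by omega⟩).val : ℤ) else 0)) = binaryPhase a b z := by
  have hs : ∀ x y : ZMod 2, signChar (x * y) = (-1) ^ (x.val * y.val) := by
    intro x y
    obtain rfl | rfl := x.two_eq_zero_or_eq_one <;>
      obtain rfl | rfl := y.two_eq_zero_or_eq_one <;>
      simp [signChar, ZMod.val_one]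
  rw [binaryPhase, zpow_add₀ Complex.I_ne_zero, zpow_mul]
  congr 1
  · simp only [hs, Finset.prod_pow_eq_pow_sum]
    rw [← zpow_natCast (-1 : ℂ)]
    push_cast
    congr 1
    exact_mod_cast Complex.I_sq
  · split_ifs
    exacts [zpow_natCast _ _, zpow_zero _]

lemma binaryPhase_mul_star (z : Fin (2 * a + b) → ZMod 2) :
    binaryPhase a b z * star (binaryPhase a b z) = 1 := by
  rw [← binaryPhase_eq, star_zpow₀, ← mul_zpow]
  simp

lemma binaryPhase_add_single_left (z : Fin (2 * a + b) → ZMod 2) (i : Fin a) :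
    binaryPhase a b (z + Pi.single ⟨i.1, by omega⟩ 1) =
      binaryPhase a b z * signChar (z ⟨a + i.1, by omega⟩) := by
  have h : ∀ k : Fin a, signChar (
      (z + Pi.single ⟨i.1, by omega⟩ 1 : Fin (2 * a + b) → ZMod 2) ⟨k.1, by omega⟩ *
      (z + Pi.single ⟨i.1, by omega⟩ 1 : Fin (2 * a + b) → ZMod 2) ⟨a + k.1, by omega⟩) =
      signChar (z ⟨k.1, by omega⟩ * z ⟨a + k.1, by omega⟩) *
        if i = k then signChar (z ⟨a + k.1, by omega⟩) else 1 := fun k => by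
    have h1 : a + k.1 ≠ i.1 := by omega
    by_cases hk : i = k
    · subst hk
      simp [i.pos.ne', add_mul, signChar_add]
    · have h2 : k.1 ≠ i.1 := fun h => hk (Fin.ext h.symm)
      simp [h1, h2, hk]
  have h3 : 2 * a ≠ i.1 := by omega
  simp only [binaryPhase, h, Finset.prod_mul_distrib, Finset.prod_ite_eq, Finset.mem_univ, if_true]
  simp only [Pi.add_apply, Pi.single_apply, Fin.mk.injEq, h3, if_false, add_zero]
  exact mul_right_comm _ _ _

lemma binaryPhase_add_single_right (z : Fin (2 * a + b) → ZMod 2) (i : Fin a) :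
    binaryPhase a b (z + Pi.single ⟨a + i.1, by omega⟩ 1) =
      binaryPhase a b z * signChar (z ⟨i.1, by omega⟩) := by
  have h : ∀ k : Fin a, signChar (
      (z + Pi.single ⟨a + i.1, by omega⟩ 1 : Fin (2 * a + b) → ZMod 2) ⟨k.1, by omega⟩ *
      (z + Pi.single ⟨a + i.1, by omega⟩ 1 : Fin (2 * a + b) → ZMod 2) ⟨a + k.1, by omega⟩) =
      signChar (z ⟨k.1, by omega⟩ * z ⟨a + k.1, by omega⟩) *
        if i = k then signChar (z ⟨k.1, by omega⟩) else 1 := fun k => by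
    have h1 : k.1 ≠ a + i.1 := by omega
    by_cases hk : i = k
    · subst hk
      simp [i.pos.ne', mul_add, signChar_add]
    · have h2 : k.1 ≠ i.1 := fun h => hk (Fin.ext h.symm)
      simp [h1, h2, hk]
  have h3 : 2 * a ≠ a + i.1 := by omega
  simp only [binaryPhase, h, Finset.prod_mul_distrib, Finset.prod_ite_eq, Finset.mem_univ, if_true]
  simp only [Pi.add_apply, Pi.single_apply, Fin.mk.injEq, h3, if_false, add_zero]
  exact mul_right_comm _ _ _

lemma sum_eq_zero_of_shift_neg {A : Type*} [AddCommGroup A] [Fintype A] {g : A → ℂ} (t : A)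
    (h : ∀ x, g (x + t) = -g x) : ∑ x, g x = 0 := by
  have h1 : ∑ x, g (x + t) = ∑ x, g x := Equiv.sum_comp (Equiv.addRight t) g
  simp only [h, Finset.sum_neg_distrib] at h1
  exact neg_eq_self.1 h1

/-- If shifting by `t` multiplies the phase by the sign of the `j`-th coordinate and `w j ≠ 0`,
then the autocorrelation at `w` vanishes. -/
lemma sum_binaryPhase_eq_zero {w t : Fin (2 * a + b) → ZMod 2} {j : Fin (2 * a + b)}
    (hj : w j ≠ 0) (ht : ∀ z, binaryPhase a b (z + t) = binaryPhase a b z * signChar (z j)) :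
    ∑ z, binaryPhase a b z * star (binaryPhase a b (z + w)) = 0 := by
  have hsgn : ∀ x y : ZMod 2, y ≠ 0 → signChar x * star (signChar (x + y)) = -1 := by
    intro x y
    obtain rfl | rfl := x.two_eq_zero_or_eq_one <;>
      obtain rfl | rfl := y.two_eq_zero_or_eq_one <;>
      simp [signChar, ZMod.val_one, CharTwo.add_self_eq_zero]
  refine sum_eq_zero_of_shift_neg t fun z => ?_
  rw [add_right_comm, ht, ht, star_mul', Pi.add_apply, mul_mul_mul_comm, hsgn _ _ hj, mul_neg_one]

lemma hasPerfectAutocorrelation_binaryPhase (hb : b = 0 ∨ b = 1) :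
    HasPerfectAutocorrelation (binaryPhase a b) := by
  intro w
  split_ifs with hw
  · simp only [hw, add_zero, binaryPhase_mul_star, Finset.sum_const, Finset.card_univ,
      nsmul_eq_mul, mul_one]
  by_cases h1 : ∃ i : Fin a, w ⟨i.1, by omega⟩ ≠ 0
  · obtain ⟨i, hi⟩ := h1
    exact sum_binaryPhase_eq_zero hi fun z => binaryPhase_add_single_right z i
  by_cases h2 : ∃ i : Fin a, w ⟨a + i.1, by omega⟩ ≠ 0
  · obtain ⟨i, hi⟩ := h2
    exact sum_binaryPhase_eq_zero hi fun z => binaryPhase_add_single_left z i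
  push Not at h1 h2
  obtain ⟨j, hj⟩ := Function.ne_iff.1 hw
  have hlow : ∀ k : Fin (2 * a + b), k.1 < 2 * a → w k = 0 := fun k hk => by
    by_cases hka : k.1 < a
    · exact h1 ⟨k, hka⟩
    · have h := h2 ⟨k.1 - a, by omega⟩
      rwa [show (⟨a + (k.1 - a), by omega⟩ : Fin (2 * a + b)) = k from Fin.ext (by simp; omega)] at h
  have hja : ¬ j.1 < 2 * a := fun h => hj (hlow j h)
  obtain rfl : b = 1 := by omega
  have hlast : w ⟨2 * a, by omega⟩ ≠ 0 := by
    rwa [show (⟨2 * a, by omega⟩ : Fin (2 * a + 1)) = j from Fin.ext (by simp; omega)]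
  set P : (Fin (2 * a + 1) → ZMod 2) → ℂ := fun z =>
    ∏ i : Fin a, signChar (z ⟨i.1, by omega⟩ * z ⟨a + i.1, by omega⟩) with hP
  have hphase : ∀ z, binaryPhase a 1 z = P z * Complex.I ^ (z ⟨2 * a, by omega⟩).val :=
    fun z => by simp [binaryPhase, hP]
  have hPw : ∀ z, P (z + w) = P z := fun z => by
    refine Finset.prod_congr rfl fun i _ => ?_
    rw [Pi.add_apply, Pi.add_apply, h1 i, h2 i, add_zero, add_zero]
  have hI : ∀ x y : ZMod 2, y ≠ 0 → Complex.I ^ (x + y).val * star (Complex.I ^ (x + y + y).val) =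
      -(Complex.I ^ x.val * star (Complex.I ^ (x + y).val)) := by
    intro x y
    obtain rfl | rfl := x.two_eq_zero_or_eq_one <;>
      obtain rfl | rfl := y.two_eq_zero_or_eq_one <;>
      simp [ZMod.val_one, CharTwo.add_self_eq_zero]
  refine sum_eq_zero_of_shift_neg w fun z => ?_
  simp only [hphase, hPw, star_mul', Pi.add_apply]
  linear_combination (P z * star (P z)) * hI (z ⟨2 * a, by omega⟩) _ hlast

end Binary

/-- Theorem 2.1 of the paper. Let `K = G × L` where `L = {0,1}^(2a+b)`
(`b ∈ {0,1}`; `L` is trivial when `2a+b = 0`), `e = exp(G)`, `U ≤ G` a subgroup all of whose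
elements have square roots in `G` (a choice `σ` of square roots is fixed),
`f : G × G → ℤ_e` bilinear, symmetric, nondegenerate with no element of `G \ U`
orthogonal to all of `U`, `R` a complete system of coset representatives of `U` in `G`
with `0 ∈ R` (with `x = p1 x + p2 x` the unique decomposition, `p1 x ∈ U`, `p2 x ∈ R`),
and `β` an integer coprime to `|G|`.  Then the matrix
`H_{y,x} = ζ_e^(f(σ((x-y)_1), (x-y)_1) + β f((x-y)_1,(x-y)_2)) ζ_4^(s_L(x_3 ⊕ y_3))`
is a `BH(K, e_1)` matrix, with `e_1 = exp U` if `L = {0}`, `e_1 = lcm(2, exp U)` if `|L|` is a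
square, and `e_1 = lcm(4, exp U)` otherwise. -/
theorem statement1
    (G : Type) [AddCommGroup G] [Fintype G] [DecidableEq G]
    (a b : ℕ) (hb : b = 0 ∨ b = 1)
    (e : ℕ) (he : e = AddMonoid.exponent G)
    (U : AddSubgroup G)
    (σ : G → G) (hσ : ∀ u ∈ U, 2 • σ u = u)
    (f : G → G → ZMod e)
    (hf1 : ∀ g h k : G, f (g + h) k = f g k + f h k)
    (hf2 : ∀ g h k : G, f g (h + k) = f g h + f g k)
    (hfsym : ∀ g h : G, f g h = f h g)
    (hfnd : ∀ g : G, (∀ x : G, f g x = 0) → g = 0)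
    (hfU : ∀ g : G, (∀ u ∈ U, f g u = 0) → g ∈ U)
    (R : Set G) (h0R : (0 : G) ∈ R)
    (p1 p2 : G → G)
    (hp1 : ∀ x, p1 x ∈ U) (hp2 : ∀ x, p2 x ∈ R)
    (hdecomp : ∀ x, x = p1 x + p2 x)
    (huniq : ∀ x : G, ∀ u ∈ U, ∀ r ∈ R, x = u + r → u = p1 x ∧ r = p2 x)
    (β : ℤ) (hβ : IsCoprime β (Fintype.card G : ℤ))
    (sL : (Fin (2 * a + b) → ZMod 2) → ℤ)
    (hsL : ∀ g : Fin (2 * a + b) → ZMod 2,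
      sL g = 2 * ∑ i : Fin a,
          ((g ⟨i.1, by omega⟩).val : ℤ) * ((g ⟨a + i.1, by omega⟩).val : ℤ)
        + (if h : b = 1 then ((g ⟨2 * a, by omega⟩).val : ℤ) else 0))
    (H : Matrix (G × (Fin (2 * a + b) → ZMod 2)) (G × (Fin (2 * a + b) → ZMod 2)) ℂ)
    (hH : ∀ y x : G × (Fin (2 * a + b) → ZMod 2), H y x =
      Complex.exp (2 * Real.pi * Complex.I / e) ^
        (f (σ (p1 (x.1 - y.1))) (p1 (x.1 - y.1))
          + β • f (p1 (x.1 - y.1)) (p2 (x.1 - y.1))).val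
      * Complex.I ^ sL (x.2 + y.2))
    (e1 : ℕ)
    (he1 : e1 = if 2 * a + b = 0 then AddMonoid.exponent U
      else if b = 0 then Nat.lcm 2 (AddMonoid.exponent U)
      else Nat.lcm 4 (AddMonoid.exponent U)) :
    IsBHMatrix H e1 := by
  subst he
  have : NeZero (AddMonoid.exponent G) := ⟨AddMonoid.exponent_ne_zero_of_finite⟩
  let B : G →+ G →+ ZMod (AddMonoid.exponent G) :=
    AddMonoidHom.mk' (fun g => AddMonoidHom.mk' (f g) (hf2 g)) fun g h => by
      ext k
      exact hf1 g h k
  have hζ : ∀ x : ZMod (AddMonoid.exponent G),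
      Complex.exp (2 * Real.pi * Complex.I / (AddMonoid.exponent G : ℕ)) ^ x.val =
        ZMod.stdAddChar x := fun x => by
    conv_rhs => rw [← ZMod.natCast_zmod_val x, ← Int.cast_natCast, ZMod.stdAddChar_coe]
    rw [← Complex.exp_nat_mul]
    congr 1
    push_cast
    ring
  have hG : HasPerfectAutocorrelation fun x => (ZMod.stdAddChar
      (f (σ (p1 x)) (p1 x) + β • f (p1 x) (p2 x)) : ℂ) :=
    hasPerfectAutocorrelation_halfForm B hfsym hfnd hσ hfU hp1 hp2 hdecomp huniq hβ
  have hphase : ∀ z, Complex.I ^ sL z = binaryPhase a b z := fun z => by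
    rw [hsL, binaryPhase_eq]
  refine (hG.prod (hasPerfectAutocorrelation_binaryPhase hb)).isBHMatrix (fun x => ?_) fun y x => ?_
  · have hU : ∀ x : G, (ZMod.stdAddChar (f (σ (p1 x)) (p1 x) + β • f (p1 x) (p2 x)) : ℂ) ^
        AddMonoid.exponent U = 1 := fun x => by
      have h0 : AddMonoid.exponent U • p1 x = 0 :=
        congrArg Subtype.val (AddMonoid.exponent_nsmul_eq_zero (⟨p1 x, hp1 x⟩ : U))
      have hB : ∀ g, AddMonoid.exponent U • B g (p1 x) = 0 := fun g => by
        rw [← map_nsmul, h0, map_zero]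
      have h1 : AddMonoid.exponent U • f (σ (p1 x)) (p1 x) = 0 := hB _
      have h2 : AddMonoid.exponent U • f (p1 x) (p2 x) = 0 := by
        rw [hfsym]
        exact hB _
      rw [← AddChar.map_nsmul_eq_pow, nsmul_add, h1, smul_comm, h2, smul_zero, add_zero,
        AddChar.map_zero_eq_one]
    have hdvd : AddMonoid.exponent U ∣ e1 := by
      rw [he1]
      split_ifs
      exacts [dvd_rfl, Nat.dvd_lcm_right _ _, Nat.dvd_lcm_right _ _]
    have hUe : ∀ x : G, (ZMod.stdAddChar (f (σ (p1 x)) (p1 x) + β • f (p1 x) (p2 x)) : ℂ) ^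
        e1 = 1 := fun x => by
      obtain ⟨k, rfl⟩ := hdvd
      rw [pow_mul, hU, one_pow]
    have hL : binaryPhase a b x.2 ^ e1 = 1 := by
      by_cases hc : 2 * a + b = 0
      · obtain ⟨rfl, rfl⟩ : a = 0 ∧ b = 0 := by omega
        simp [binaryPhase]
      rw [if_neg hc] at he1
      obtain rfl | rfl := hb
      · obtain ⟨k, hk⟩ : 2 ∣ e1 := by
          rw [he1]
          exact Nat.dvd_lcm_left _ _
        have h2 : binaryPhase a 0 x.2 ^ 2 = 1 := by
          simp [binaryPhase, signChar, ← Finset.prod_pow, ← pow_mul, mul_comm _ 2, pow_mul _ 2]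
        rw [hk, pow_mul, h2, one_pow]
      · obtain ⟨k, hk⟩ : 4 ∣ e1 := by
          rw [he1]
          exact Nat.dvd_lcm_left _ _
        have h4 : binaryPhase a 1 x.2 ^ 4 = 1 := by
          rw [← hphase, ← zpow_natCast, zpow_comm, zpow_natCast, Complex.I_pow_four, one_zpow]
        rw [hk, pow_mul, h4, one_pow]
    rw [mul_pow, hUe, hL, one_mul]
  · have hxy : x.2 + y.2 = x.2 - y.2 := by
      ext i
      rw [Pi.add_apply, Pi.sub_apply, CharTwo.sub_eq_add]
    rw [hH, hζ, hphase, hxy]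
    rfl
end

section
/- Let K be a finite abelian group and let h be a positive integer such that (i) ν_p(h) ≥ ⌈ν_p(exp(K))/2⌉ for every prime divisor p of |K|, and (ii) ν_2(h) ≥ 2 if ν_2(|K|) is odd and K has a direct factor ℤ_2 (i.e., K ≅ ℤ_2 × V for some group V). Then there exists a BH(K, h) matrix. -/
open scoped BigOperators

/-- `G` carries a function with values in the `h`-th roots of unity whose nontrivial periodic
autocorrelations all vanish. -/
def HasPerfectArray (G : Type*) [AddCommGroup G] [Fintype G] (h : ℕ) : Prop :=
  ∃ f : G → ℂ, (∀ x, f x ^ h = 1) ∧ ∀ a, a ≠ 0 → ∑ x, f x * (f (x + a))⁻¹ = 0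

section Sums

variable {G : Type*} [AddCommGroup G] [Fintype G]

theorem sum_eq_zero_of_shift_eigen (g : G → ℂ) (t : G) (κ : ℂ) (hκ : κ ≠ 1)
    (hg : ∀ x, g (x + t) = κ * g x) : ∑ x, g x = 0 := by
  have h1 : ∑ x, g (x + t) = ∑ x, g x := Equiv.sum_comp (Equiv.addRight t) g
  simp only [hg, ← Finset.mul_sum] at h1
  by_contra h0
  exact hκ (mul_right_cancel₀ h0 (by rw [h1, one_mul]))

end Sums

namespace HasPerfectArray

variable {G G' : Type*} [AddCommGroup G] [Fintype G] [AddCommGroup G'] [Fintype G']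

theorem mono {h h' : ℕ} (hd : h ∣ h') : HasPerfectArray G h → HasPerfectArray G h' := by
  rintro ⟨f, h1, h2⟩
  obtain ⟨k, rfl⟩ := hd
  exact ⟨f, fun x => by rw [pow_mul, h1, one_pow], h2⟩

theorem congr {h : ℕ} (e : G ≃+ G') : HasPerfectArray G' h → HasPerfectArray G h := by
  rintro ⟨f, h1, h2⟩
  refine ⟨fun x => f (e x), fun x => h1 _, fun a ha => ?_⟩
  simp only [map_add]
  rw [← h2 (e a) (by simpa using ha)]
  exact Equiv.sum_comp e.toEquiv (fun y => f y * (f (y + e a))⁻¹)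

theorem pi {ι : Type*} [Fintype ι] [DecidableEq ι] {G : ι → Type*} [∀ i, AddCommGroup (G i)]
    [∀ i, Fintype (G i)] {h : ℕ} (hG : ∀ i, HasPerfectArray (G i) h) :
    HasPerfectArray (∀ i, G i) h := by
  choose f h1 h2 using hG
  refine ⟨fun x => ∏ i, f i (x i), fun x => ?_, fun a ha => ?_⟩
  · rw [← Finset.prod_pow]
    exact Finset.prod_eq_one fun i _ => h1 i _
  · obtain ⟨i, hi⟩ := Function.ne_iff.mp ha
    simp only [← Finset.prod_inv_distrib, ← Finset.prod_mul_distrib, Pi.add_apply]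
    rw [← Fintype.prod_sum (fun i y => f i y * (f i (y + a i))⁻¹)]
    exact Finset.prod_eq_zero (Finset.mem_univ i) (h2 i _ hi)

theorem prod {h : ℕ} : HasPerfectArray G h → HasPerfectArray G' h →
    HasPerfectArray (G × G') h := by
  rintro ⟨f, h1, h2⟩ ⟨g, h3, h4⟩
  refine ⟨fun x => f x.1 * g x.2, fun x => by rw [mul_pow, h1, h3, one_mul], fun a ha => ?_⟩
  have key : ∑ x : G × G', f x.1 * g x.2 * (f (x + a).1 * g (x + a).2)⁻¹
      = (∑ x, f x * (f (x + a.1))⁻¹) * ∑ y, g y * (g (y + a.2))⁻¹ := by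
    rw [Finset.sum_mul_sum, Fintype.sum_prod_type]
    refine Finset.sum_congr rfl fun x _ => Finset.sum_congr rfl fun y _ => ?_
    simp only [Prod.fst_add, Prod.snd_add, mul_inv]
    ring
  rw [key]
  by_cases h : a.1 = 0
  · rw [h4 a.2 (fun h' => ha (Prod.ext h h')), mul_zero]
  · rw [h2 _ h, zero_mul]

theorem exists_isBHMatrix {K : Type} [AddCommGroup K] [Fintype K] [DecidableEq K] {h : ℕ}
    (hh : 0 < h) : HasPerfectArray K h → ∃ H : Matrix K K ℂ, IsBHMatrix H h := by
  rintro ⟨f, h1, h2⟩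
  have hn : ∀ x, ‖f x‖ = 1 := fun x => Complex.norm_eq_one_of_pow_eq_one (h1 x) hh.ne'
  refine ⟨Matrix.of fun g k => f (g - k), fun g k => h1 _, fun g k l => by simp, ?_⟩
  ext g g'
  have key : ∑ k, f (g - k) * star (f (g' - k)) = ∑ x, f x * (f (x + (g' - g)))⁻¹ := by
    rw [← Equiv.sum_comp (Equiv.subLeft g)]
    refine Finset.sum_congr rfl fun x _ => ?_
    rw [Complex.inv_eq_conj (hn _)]
    simp only [Equiv.subLeft_apply, sub_sub_cancel, starRingEnd_apply]
    congr 3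
    abel
  rw [Matrix.mul_apply]
  simp only [Matrix.conjTranspose_apply, Matrix.of_apply]
  rw [key]
  by_cases hg : g = g'
  · subst hg
    have hne : ∀ x, f x ≠ 0 := fun x h0 => by simpa [h0] using hn x
    simp [hne]
  · rw [h2 _ (sub_ne_zero.mpr (Ne.symm hg))]
    simp [hg]

end HasPerfectArray

/-- The generalized Frank chirp with block length `m`. -/
noncomputable def frankChirp (m : ℕ) (η ζ : ℂ) (x : ℤ) : ℂ :=
  η ^ ((x / m) ^ 2) * ζ ^ ((x % m) * (x / m))

section FrankChirp

variable {m s : ℕ} {η ζ : ℂ}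

theorem frankChirp_ne_zero (hη : η ≠ 0) (hζ : ζ ≠ 0) (x : ℤ) : frankChirp m η ζ x ≠ 0 :=
  mul_ne_zero (zpow_ne_zero _ hη) (zpow_ne_zero _ hζ)

theorem frankChirp_pow {h : ℕ} (hη : η ^ h = 1) (hζ : ζ ^ h = 1) (x : ℤ) :
    frankChirp m η ζ x ^ h = 1 := by
  rw [frankChirp, mul_pow, ← zpow_natCast, ← zpow_natCast, ← zpow_mul, ← zpow_mul,
    mul_comm _ (h : ℤ), mul_comm _ (h : ℤ), zpow_mul, zpow_mul, zpow_natCast, zpow_natCast, hη, hζ,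
    one_zpow, one_zpow, one_mul]

theorem frankChirp_add_mul (hm : m ≠ 0) (hη : η ≠ 0) (hζ : ζ ≠ 0) (x v : ℤ) :
    frankChirp m η ζ (x + m * v) =
      frankChirp m η ζ x * (η ^ (v ^ 2) * (η ^ 2) ^ ((x / m) * v) * ζ ^ ((x % m) * v)) := by
  have hm' : (m : ℤ) ≠ 0 := by exact_mod_cast hm
  rw [frankChirp, frankChirp, Int.add_mul_ediv_left _ _ hm', Int.add_mul_emod_self_left,
    ← zpow_natCast η 2, ← zpow_mul, mul_add, zpow_add₀ hζ,
    show (x / m + v) ^ 2 = (x / m) ^ 2 + v ^ 2 + (2 : ℕ) * (x / m * v) by push_cast; ring,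
    zpow_add₀ hη, zpow_add₀ hη]
  ring

theorem frankChirp_add_mul_mul (hm : m ≠ 0) (hη : η ≠ 0) (hζ : ζ ≠ 0) (h1 : (η ^ 2) ^ s = 1)
    (h2 : η ^ s ^ 2 = 1) (h3 : ζ ^ (s * m) = 1) (x w : ℤ) :
    frankChirp m η ζ (x + m * (s * w)) = frankChirp m η ζ x * (ζ ^ s) ^ (x * w) := by
  rw [frankChirp_add_mul hm hη hζ]
  have e1 : η ^ (((s : ℤ) * w) ^ 2) = 1 := by
    rw [mul_pow, zpow_mul, show ((s : ℤ) ^ 2) = ((s ^ 2 : ℕ) : ℤ) by push_cast; ring, zpow_natCast,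
      h2, one_zpow]
  have e2 : (η ^ 2) ^ ((x / m) * (s * w)) = 1 := by
    rw [mul_left_comm, zpow_mul, zpow_natCast, h1, one_zpow]
  have e3 : (ζ ^ s) ^ (x * w) = ζ ^ ((x % m) * (s * w)) := by
    rw [← zpow_natCast ζ s, ← zpow_mul]
    conv_lhs => rw [← Int.emod_add_mul_ediv x m]
    rw [show (s : ℤ) * ((x % m + m * (x / m)) * w)
      = (x % m) * (s * w) + ((s * m : ℕ) : ℤ) * ((x / m) * w) by push_cast; ring, zpow_add₀ hζ,
      zpow_mul ζ ((s * m : ℕ) : ℤ), zpow_natCast, h3, one_zpow, mul_one]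
  rw [e1, e2, e3, one_mul, one_mul]

end FrankChirp

theorem hasPerfectArray_zmod_mul_sq {m s h : ℕ} [NeZero m] [NeZero s] {η : ℂ}
    (hη : IsPrimitiveRoot (η ^ 2) s) (hs : η ^ s ^ 2 = 1) (hηh : η ^ h = 1) (hd : s * m ∣ h) :
    HasPerfectArray (ZMod (s * m ^ 2)) h := by
  have hm0 : m ≠ 0 := NeZero.ne m
  have hs0 : s ≠ 0 := NeZero.ne s
  have hη0 : η ≠ 0 := by
    rintro rfl
    simp [hs0] at hs
  obtain ⟨ζ, hζ⟩ : ∃ ζ : ℂ, IsPrimitiveRoot ζ (s * m) :=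
    ⟨_, Complex.isPrimitiveRoot_exp _ (mul_ne_zero hs0 hm0)⟩
  have hζ0 : ζ ≠ 0 := hζ.ne_zero (mul_ne_zero hs0 hm0)
  have hω : IsPrimitiveRoot (ζ ^ s) m := hζ.pow (Nat.pos_of_ne_zero (mul_ne_zero hs0 hm0)) rfl
  have hω0 : ζ ^ s ≠ 0 := pow_ne_zero _ hζ0
  set F := frankChirp m η ζ with hF
  have hF0 : ∀ x, F x ≠ 0 := frankChirp_ne_zero hη0 hζ0
  have hblock : ∀ x w : ℤ, F (x + m * (s * w)) = F x * (ζ ^ s) ^ (x * w) :=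
    frankChirp_add_mul_mul hm0 hη0 hζ0 hη.pow_eq_one hs hζ.pow_eq_one
  have hper : ∀ x k : ℤ, F (x + (s * m ^ 2 : ℕ) * k) = F x := fun x k => by
    rw [show x + ((s * m ^ 2 : ℕ) : ℤ) * k = x + m * (s * (m * k)) by push_cast; ring, hblock,
      mul_left_comm, zpow_mul, zpow_natCast, hω.pow_eq_one, one_zpow, mul_one]
  have hcast : ∀ k : ℤ, F ((k : ZMod (s * m ^ 2)).cast) = F k := fun k => by
    have h1 : ((s * m ^ 2 : ℕ) : ℤ) ∣ (k : ZMod (s * m ^ 2)).cast - k := by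
      rw [← ZMod.intCast_zmod_eq_zero_iff_dvd]
      simp
    obtain ⟨j, hj⟩ := h1
    rw [← hper k j, ← hj, add_sub_cancel]
  have hζh : ζ ^ h = 1 := (hζ.pow_eq_one_iff_dvd h).mpr hd
  refine ⟨fun x => F x.cast, fun x => frankChirp_pow hηh hζh _, fun a ha => ?_⟩
  obtain ⟨c, rfl⟩ := ZMod.intCast_surjective a
  have hc : ¬ ((s * m ^ 2 : ℕ) : ℤ) ∣ c := by rwa [← ZMod.intCast_zmod_eq_zero_iff_dvd]
  have main : ∀ (t : ℤ) (κ : ℂ), κ ≠ 1 →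
      (∀ x : ℤ, F (x + t) * (F (x + t + c))⁻¹ = κ * (F x * (F (x + c))⁻¹)) →
      ∑ x : ZMod (s * m ^ 2), F x.cast * (F (x + (c : ZMod (s * m ^ 2))).cast)⁻¹ = 0 := by
    intro t κ hκ hx
    refine sum_eq_zero_of_shift_eigen _ (t : ZMod (s * m ^ 2)) κ hκ fun x => ?_
    obtain ⟨k, rfl⟩ := ZMod.intCast_surjective x
    simp only [← Int.cast_add, hcast]
    exact hx k
  by_cases h1 : (m : ℤ) ∣ c
  · obtain ⟨v, rfl⟩ := h1
    by_cases h2 : (s : ℤ) ∣ v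
    · obtain ⟨w, rfl⟩ := h2
      refine main 1 ((ζ ^ s) ^ (-w)) ?_ fun x => ?_
      · rw [Ne, hω.zpow_eq_one_iff_dvd, dvd_neg]
        rintro ⟨j, rfl⟩
        exact hc ⟨j, by push_cast; ring⟩
      · rw [hblock, hblock, add_mul, one_mul, zpow_add₀ hω0, zpow_neg]
        have := hF0 x
        have := hF0 (x + 1)
        have := zpow_ne_zero (x * w) hω0
        have := zpow_ne_zero w hω0
        field_simp
    · refine main m ((η ^ 2) ^ (-v)) ?_ fun x => ?_
      · rwa [Ne, hη.zpow_eq_one_iff_dvd, dvd_neg]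
      · have hm' : (m : ℤ) ≠ 0 := by exact_mod_cast hm0
        have e1 : ((x + m) / m : ℤ) = x / m + 1 := by
          simpa using Int.add_mul_ediv_left x 1 hm'
        rw [hF, frankChirp_add_mul hm0 hη0 hζ0, frankChirp_add_mul hm0 hη0 hζ0, ← hF, e1,
          Int.add_emod_right, add_mul, one_mul, zpow_add₀ (pow_ne_zero 2 hη0), zpow_neg]
        have := hF0 x
        have := hF0 (x + m)
        have := zpow_ne_zero (v ^ 2) hη0
        have := zpow_ne_zero (x / m * v) (pow_ne_zero 2 hη0)
        have := zpow_ne_zero v (pow_ne_zero 2 hη0)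
        have := zpow_ne_zero (x % m * v) hζ0
        field_simp
  · refine main (m * (s * 1)) ((ζ ^ s) ^ (-c)) ?_ fun x => ?_
    · rwa [Ne, hω.zpow_eq_one_iff_dvd, dvd_neg]
    · rw [add_right_comm, hblock, hblock, mul_one, mul_one, zpow_add₀ hω0, zpow_neg]
      have := hF0 x
      have := hF0 (x + c)
      have := zpow_ne_zero x hω0
      have := zpow_ne_zero c hω0
      field_simp

theorem hasPerfectArray_zmod_sq {m h : ℕ} [NeZero m] (hd : m ∣ h) :
    HasPerfectArray (ZMod (m ^ 2)) h := by
  have := hasPerfectArray_zmod_mul_sq (m := m) (s := 1) (h := h) (η := 1) (by simp) (by simp)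
    (by simp) (by simpa using hd)
  exact this.congr (ZMod.ringEquivCongr (one_mul (m ^ 2)).symm).toAddEquiv

theorem hasPerfectArray_zmod_odd_mul_sq {m s h : ℕ} [NeZero m] [NeZero s] (hs : Odd s) (hd : s * m ∣ h) :
    HasPerfectArray (ZMod (s * m ^ 2)) h := by
  have hη := Complex.isPrimitiveRoot_exp s hs.pos.ne'
  refine hasPerfectArray_zmod_mul_sq
    (hη.pow_of_coprime 2 (Nat.coprime_two_left.mpr hs)) ?_ ?_ hd
  · exact (hη.pow_eq_one_iff_dvd _).mpr (dvd_pow_self s two_ne_zero)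
  · exact (hη.pow_eq_one_iff_dvd _).mpr ((dvd_mul_right s m).trans hd)

theorem hasPerfectArray_zmod_two_mul_sq {m h : ℕ} [NeZero m] (h4 : 4 ∣ h) (hd : 2 * m ∣ h) :
    HasPerfectArray (ZMod (2 * m ^ 2)) h := by
  refine hasPerfectArray_zmod_mul_sq (η := Complex.I) ?_ ?_ ?_ hd
  · rw [Complex.I_sq]
    exact IsPrimitiveRoot.neg_one 0 (by norm_num)
  · norm_num [Complex.I_pow_four]
  · obtain ⟨k, rfl⟩ := h4
    rw [pow_mul, Complex.I_pow_four, one_pow]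

theorem hasPerfectArray_zmod_two_prod {h : ℕ} (hd : 2 ∣ h) :
    HasPerfectArray (ZMod 2 × ZMod 2) h := by
  refine HasPerfectArray.mono hd ?_
  let g : ZMod 2 × ZMod 2 → ℤ := fun x => if x = (1, 1) then -1 else 1
  have hinv : ∀ x, ((g x : ℂ))⁻¹ = g x := fun x => by
    by_cases hx : x = (1, 1) <;> simp [g, hx]
  have hg : ∀ a : ZMod 2 × ZMod 2, a ≠ 0 → ∑ x, g x * g (x + a) = 0 := by decide
  refine ⟨fun x => g x, fun x => ?_, fun a ha => ?_⟩
  · by_cases hx : x = (1, 1) <;> simp [g, hx]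
  · simp only [hinv]
    exact_mod_cast hg a ha

theorem hasPerfectArray_pi_zmod_two {ι : Type*} [Fintype ι] [DecidableEq ι] {h : ℕ}
    (hd : 2 ∣ h) (hι : Even (Fintype.card ι)) : HasPerfectArray (ι → ZMod 2) h := by
  obtain ⟨k, hk⟩ := hι
  have e : (ι → ZMod 2) ≃ₗ[ZMod 2] (Fin k → ZMod 2 × ZMod 2) :=
    LinearEquiv.ofFinrankEq _ _ (by
      rw [Module.finrank_pi, Module.finrank_pi_fintype]
      simp [hk, mul_two])
  exact (HasPerfectArray.pi fun _ => hasPerfectArray_zmod_two_prod hd).congr e.toAddEquiv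

theorem hasPerfectArray_zmod_prime_pow {p e h : ℕ} (hp : p.Prime) (hd : p ^ ((e + 1) / 2) ∣ h)
    (h4 : p ^ e = 2 → 4 ∣ h) [NeZero (p ^ e)] : HasPerfectArray (ZMod (p ^ e)) h := by
  have : NeZero p := ⟨hp.ne_zero⟩
  obtain ⟨k, rfl | rfl⟩ := Nat.even_or_odd' e
  · have e1 : p ^ (2 * k) = (p ^ k) ^ 2 := by rw [← pow_mul, mul_comm]
    rw [show (2 * k + 1) / 2 = k by lia] at hd
    exact (hasPerfectArray_zmod_sq hd).congr (ZMod.ringEquivCongr e1).toAddEquiv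
  · have e1 : p ^ (2 * k + 1) = p * (p ^ k) ^ 2 := by rw [← pow_mul, mul_comm k, pow_succ']
    rw [show (2 * k + 1 + 1) / 2 = k + 1 by lia, pow_succ'] at hd
    refine HasPerfectArray.congr (ZMod.ringEquivCongr e1).toAddEquiv ?_
    obtain rfl | hodd := hp.eq_two_or_odd'
    · refine hasPerfectArray_zmod_two_mul_sq ?_ hd
      cases k with
      | zero => exact h4 rfl
      | succ k => exact (Dvd.intro _ (by ring : 4 * 2 ^ k = 2 * 2 ^ (k + 1))).trans hd
    · exact hasPerfectArray_zmod_odd_mul_sq hodd hd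

/-- Splitting a product of additive groups along a predicate on the index set. -/
def piAddEquivSubtypeProd {ι : Type*} (q : ι → Prop) [DecidablePred q] (G : ι → Type*)
    [∀ i, AddCommGroup (G i)] :
    (∀ i, G i) ≃+ (∀ i : {i // q i}, G i) × (∀ i : {i // ¬ q i}, G i) :=
  { Equiv.piEquivPiSubtypeProd q G with map_add' := fun _ _ => rfl }

theorem even_padicValNat_prod {ι : Type*} (s : Finset ι) (f : ι → ℕ) (q : ℕ) [Fact q.Prime]
    (hf : ∀ i ∈ s, f i ≠ 0 ∧ Even (padicValNat q (f i))) :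
    Even (padicValNat q (∏ i ∈ s, f i)) := by
  refine (Finset.prod_induction f (fun n => n ≠ 0 ∧ Even (padicValNat q n)) ?_ (by simp) hf).2
  rintro a b ⟨ha, ha'⟩ ⟨hb, hb'⟩
  exact ⟨mul_ne_zero ha hb, by rw [padicValNat.mul ha hb]; exact ha'.add hb'⟩

/-- Corollary 2.3 of the paper. Let `K` be a finite abelian group and `h`
a positive integer such that (i) `ν_p(h) ≥ ⌈ν_p(exp K)/2⌉` for every prime `p` dividing `|K|`,
and (ii) `ν_2(h) ≥ 2` if `ν_2(|K|)` is odd and `K` has a direct factor `ℤ_2`.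
Then a `BH(K, h)` matrix exists. -/
theorem statement2
    (K : Type) [AddCommGroup K] [Fintype K] [DecidableEq K]
    (h : ℕ) (hh : 0 < h)
    (hi : ∀ p : ℕ, p.Prime → p ∣ Fintype.card K →
      (padicValNat p (AddMonoid.exponent K) + 1) / 2 ≤ padicValNat p h)
    (hii : Odd (padicValNat 2 (Fintype.card K)) →
      (∃ (V : Type) (_ : AddCommGroup V), Nonempty (K ≃+ ZMod 2 × V)) →
      2 ≤ padicValNat 2 h) :
    ∃ H : Matrix K K ℂ, IsBHMatrix H h := by
  classical
  refine HasPerfectArray.exists_isBHMatrix hh ?_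
  obtain ⟨ι, _, p, hp, e, ⟨E⟩⟩ := AddCommGroup.equiv_directSum_zmod_of_finite K
  have E : K ≃+ ∀ i, ZMod (p i ^ e i) := E.trans (DirectSum.addEquivProd _)
  have hne : ∀ i, NeZero (p i ^ e i) := fun i => ⟨pow_ne_zero _ (hp i).ne_zero⟩
  have hcard : Fintype.card K = ∏ i, p i ^ e i := by
    rw [Fintype.card_congr E.toEquiv, Fintype.card_pi]
    simp only [ZMod.card]
  have hexp : AddMonoid.exponent K ≠ 0 := AddMonoid.exponent_ne_zero_of_finite
  have hle : ∀ i, e i ≤ padicValNat (p i) (AddMonoid.exponent K) := fun i => by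
    have : Fact (p i).Prime := ⟨hp i⟩
    rw [← padicValNat_dvd_iff_le hexp, AddMonoid.exponent_eq_of_addEquiv E, AddMonoid.exponent_pi]
    conv_lhs => rw [← ZMod.exponent (p i ^ e i)]
    exact Finset.dvd_lcm (Finset.mem_univ i)
  have hval : ∀ i, e i ≠ 0 →
      (padicValNat (p i) (AddMonoid.exponent K) + 1) / 2 ≤ padicValNat (p i) h := fun i h0 =>
    hi _ (hp i) (hcard ▸ (dvd_pow_self _ h0).trans (Finset.dvd_prod_of_mem _ (Finset.mem_univ i)))
  have hd : ∀ i, p i ^ ((e i + 1) / 2) ∣ h := fun i => by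
    have : Fact (p i).Prime := ⟨hp i⟩
    rcases eq_or_ne (e i) 0 with h0 | h0
    · simp [h0]
    · rw [padicValNat_dvd_iff_le hh.ne']
      have := hval i h0
      have := hle i
      lia
  by_cases h4 : ∀ i, p i ^ e i = 2 → 4 ∣ h
  · exact (HasPerfectArray.pi fun i => hasPerfectArray_zmod_prime_pow (hp i) (hd i) (h4 i)).congr E
  push Not at h4
  obtain ⟨j, hj, h4⟩ := h4
  have h4' : ¬ 2 ≤ padicValNat 2 h := by
    rwa [← padicValNat_dvd_iff_le hh.ne']
  have hpe : ∀ i, p i ^ e i = 2 → p i = 2 ∧ e i = 1 := fun i hi2 => by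
    have h0 : e i ≠ 0 := by
      intro h0
      simp [h0] at hi2
    have : p i = 2 := (Nat.prime_dvd_prime_iff_eq (hp i) Nat.prime_two).mp
      (hi2 ▸ dvd_pow_self _ h0)
    refine ⟨this, ?_⟩
    rw [this] at hi2
    exact Nat.pow_right_injective le_rfl (hi2.trans (pow_one 2).symm)
  have hsplit : ∀ (q : ι → Prop), (∀ i, q i → p i ^ e i = 2) →
      Nonempty (K ≃+ ({i // q i} → ZMod 2) × (∀ i : {i // ¬ q i}, ZMod (p i ^ e i))) :=
    fun q hq => ⟨(E.trans (piAddEquivSubtypeProd q _)).trans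
      ((AddEquiv.piCongrRight fun i : {i // q i} =>
        (ZMod.ringEquivCongr (hq i i.2)).toAddEquiv).prodCongr (AddEquiv.refl _))⟩
  have hfactor : ∃ (V : Type) (_ : AddCommGroup V), Nonempty (K ≃+ ZMod 2 × V) := by
    obtain ⟨E'⟩ := hsplit (· = j) (fun i hij => hij ▸ hj)
    exact ⟨_, _, ⟨E'.trans ((AddEquiv.piUnique fun _ => ZMod 2).prodCongr (AddEquiv.refl _))⟩⟩
  have heven : Even (padicValNat 2 (Fintype.card K)) := by
    rw [← Nat.not_odd_iff_even]
    exact fun hodd => h4' (hii hodd hfactor)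
  obtain ⟨E'⟩ := hsplit (fun i => p i ^ e i = 2) (fun _ => id)
  have hrest : Even (padicValNat 2 (∏ i : {i // ¬ p i ^ e i = 2}, p i ^ e i)) := by
    refine even_padicValNat_prod _ _ 2 fun i _ => ⟨(hne i).ne, ?_⟩
    have : Fact (p i).Prime := ⟨hp i⟩
    by_cases hp2 : p i = 2
    · have h1 : e i ≠ 1 := fun h1 => i.2 (by rw [hp2, h1, pow_one])
      rw [hp2, padicValNat.prime_pow]
      rcases eq_or_ne (e i) 0 with h0 | h0
      · simp [h0]
      · have h2 := hval i h0
        have h3 := hle i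
        rw [hp2] at h2 h3
        have : e i = 2 := by lia
        simp [this]
    · rw [padicValNat.pow, padicValNat_primes (Ne.symm hp2)]
      simp
  have hT : Even (Fintype.card {i // p i ^ e i = 2}) := by
    have hprod : (∏ i : {i // ¬ p i ^ e i = 2}, p i ^ e i) ≠ 0 :=
      Finset.prod_ne_zero_iff.mpr fun i _ => (hne i).ne
    rw [Fintype.card_congr E'.toEquiv, Fintype.card_prod, Fintype.card_pi, Fintype.card_pi] at heven
    simp only [ZMod.card, Finset.prod_const, Finset.card_univ] at heven
    rw [padicValNat.mul (by positivity) hprod, padicValNat.prime_pow] at heven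
    exact (Nat.even_add.mp heven).mpr hrest
  have h2 : 2 ∣ h := by
    have := hd j
    rwa [(hpe j hj).1, (hpe j hj).2] at this
  exact ((hasPerfectArray_pi_zmod_two h2 hT).prod (HasPerfectArray.pi
    fun i : {i // ¬ p i ^ e i = 2} => hasPerfectArray_zmod_prime_pow (hp i) (hd i) fun hi2 => absurd hi2 i.2)).congr E'
end

section
/- If v and h are positive integers with (i) ν_p(h) ≥ ⌈ν_p(v)/2⌉ for every prime divisor p of v, and (ii) ν_2(h) ≥ 2 if v ≡ 2 (mod 4), then a BH(ℤ_v, h) matrix exists (equivalently, a circulant v × v Butson Hadamard matrix with entries that are h-th roots of unity exists). -/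
open scoped BigOperators

/-- A function on `ZMod v` which is multiplied by a constant other than `1` under a translation
has sum zero. -/
theorem sum_eq_zero_of_translate {v : ℕ} [NeZero v] (g : ZMod v → ℂ) (d : ZMod v) (c : ℂ)
    (hc : c ≠ 1) (hg : ∀ x, g (x + d) = c * g x) : ∑ x, g x = 0 := by
  have h1 : ∑ x, g (x + d) = ∑ x, g x := Equiv.sum_comp (Equiv.addRight d) g
  simp only [hg, ← Finset.mul_sum] at h1
  have h2 : (c - 1) * ∑ x, g x = 0 := by linear_combination h1
  exact (mul_eq_zero.1 h2).resolve_left (sub_ne_zero.2 hc)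

/-- A unimodular function on `ZMod v` with perfect autocorrelation and values in the `h`-th roots
of unity gives a circulant Butson Hadamard matrix. -/
theorem isBHMatrix_of_autocorrelation {v h : ℕ} [NeZero v] (hh : 0 < h) (f : ZMod v → ℂ)
    (hf : ∀ x, f x ^ h = 1) (hcorr : ∀ a, a ≠ 0 → ∑ x, f (x + a) * (f x)⁻¹ = 0) :
    IsBHMatrix (Matrix.of fun g k => f (g - k)) h := by
  have hstar : ∀ x, star (f x) = (f x)⁻¹ := fun x =>
    (Complex.inv_eq_conj (Complex.norm_eq_one_of_pow_eq_one (hf x) hh.ne')).symm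
  have hne : ∀ x, f x ≠ 0 := fun x hx => by
    have := hf x
    simp [hx, hh.ne'] at this
  refine ⟨fun g k => hf _, fun g k l => by simp, ?_⟩
  ext g k
  have key : ∑ l, f (g - l) * (f (k - l))⁻¹ = ∑ x, f (x + (g - k)) * (f x)⁻¹ := by
    rw [← Equiv.sum_comp (Equiv.subLeft k) (fun x => f (x + (g - k)) * (f x)⁻¹)]
    refine Finset.sum_congr rfl fun l _ => ?_
    simp only [Equiv.subLeft_apply]
    congr 2
    ring
  simp only [Matrix.mul_apply, Matrix.conjTranspose_apply, Matrix.of_apply, hstar, key,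
    Matrix.smul_apply, Matrix.one_apply, smul_eq_mul]
  split_ifs with hgk
  · subst hgk
    simp [hne]
  · simpa using hcorr (g - k) (sub_ne_zero.2 hgk)

/-- Milewski's sequence of period `t * s ^ 2`, with a quadratic (Chu) sequence of period `t`
as outer factor. -/
noncomputable def milewski (s : ℕ) (μ ω : ℂ) (n : ℤ) : ℂ :=
  μ ^ ((n / s) ^ 2) * ω ^ ((n / s) * (n % s))

section milewski

variable {s t : ℕ} {μ ω : ℂ}

theorem milewski_ne_zero (hμ : μ ≠ 0) (hω : ω ≠ 0) (n : ℤ) : milewski s μ ω n ≠ 0 :=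
  mul_ne_zero (zpow_ne_zero _ hμ) (zpow_ne_zero _ hω)

theorem milewski_pow_eq_one {h : ℕ} (hμ : μ ^ h = 1) (hω : ω ^ h = 1) (n : ℤ) :
    milewski s μ ω n ^ h = 1 := by
  have aux : ∀ (z : ℂ) (k : ℤ), z ^ h = 1 → (z ^ k) ^ h = 1 := fun z k hz => by
    rw [← zpow_natCast, zpow_comm, zpow_natCast, hz, one_zpow]
  rw [milewski, mul_pow, aux _ _ hμ, aux _ _ hω, one_mul]

theorem milewski_add_mul (hs : 0 < s) (hμ : μ ≠ 0) (hω : ω ≠ 0) (n A : ℤ) :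
    milewski s μ ω (n + A * s) =
      milewski s μ ω n * (μ ^ (2 * (n / s) * A) * μ ^ (A ^ 2) * ω ^ (A * (n % s))) := by
  have h1 : (n + A * s) / (s : ℤ) = n / s + A := Int.add_mul_ediv_right _ _ (by positivity)
  have h2 : (n + A * s) % (s : ℤ) = n % s := Int.add_mul_emod_self_right _ _ _
  have e1 : (n / s + A) ^ 2 = (n / s) ^ 2 + (2 * (n / s) * A + A ^ 2) := by ring
  rw [milewski, milewski, h1, h2, e1, add_mul, zpow_add₀ hμ, zpow_add₀ hμ, zpow_add₀ hω]
  ring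

variable (hs : 0 < s) (ht : 0 < t) (hμ : IsPrimitiveRoot (μ ^ 2) t) (hμt : μ ^ (t ^ 2) = 1)
  (hω : IsPrimitiveRoot ω (t * s))

include ht hμ in
theorem ne_zero_of_sq_isPrimitiveRoot : μ ≠ 0 := by
  rintro rfl
  exact hμ.ne_zero ht.ne' (by simp)

include hs ht hω in
theorem ne_zero_of_isPrimitiveRoot_mul : ω ≠ 0 :=
  hω.ne_zero (Nat.mul_pos ht hs).ne'

include hμ in
theorem zpow_two_mul_eq_one_iff (A : ℤ) : μ ^ (2 * A) = 1 ↔ (t : ℤ) ∣ A := by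
  rw [← hμ.zpow_eq_one_iff_dvd, zpow_mul]
  norm_cast

include hs ht hμ hμt hω in
theorem milewski_add_period_mul (n : ℤ) :
    milewski s μ ω (n + t * s) = milewski s μ ω n * ω ^ (t * n) := by
  have hω0 := ne_zero_of_isPrimitiveRoot_mul hs ht hω
  rw [milewski_add_mul hs (ne_zero_of_sq_isPrimitiveRoot ht hμ) hω0]
  have h1 : μ ^ (2 * (n / s) * t) = 1 := by
    rw [mul_assoc, zpow_two_mul_eq_one_iff hμ]
    exact dvd_mul_left _ _
  have h2 : μ ^ ((t : ℤ) ^ 2) = 1 := by exact_mod_cast hμt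
  have h3 : ω ^ (t * n) = ω ^ (t * (n % s)) := by
    have e : t * n = (t * s : ℕ) * (n / s) + t * (n % s) := by
      conv_lhs => rw [← Int.mul_ediv_add_emod n s]
      push_cast
      ring
    have h4 : ω ^ (((t * s : ℕ) : ℤ) * (n / s)) = 1 :=
      (hω.zpow_eq_one_iff_dvd _).2 (dvd_mul_right _ _)
    rw [e, zpow_add₀ hω0, h4, one_mul]
  rw [h1, h2, h3, one_mul, one_mul]

include hs ht hμ hμt hω in
theorem milewski_periodic :
    Function.Periodic (milewski s μ ω) ((s ^ 2 * t : ℕ) : ℤ) := by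
  intro n
  have e : n + ((s ^ 2 * t : ℕ) : ℤ) = n + ((s * t : ℕ) : ℤ) * s := by
    push_cast
    ring
  rw [e, milewski_add_mul hs (ne_zero_of_sq_isPrimitiveRoot ht hμ)
    (ne_zero_of_isPrimitiveRoot_mul hs ht hω)]
  have h1 : μ ^ (2 * (n / s) * ((s * t : ℕ) : ℤ)) = 1 := by
    rw [mul_assoc, zpow_two_mul_eq_one_iff hμ]
    exact ⟨n / s * s, by push_cast; ring⟩
  have h2 : μ ^ (((s * t : ℕ) : ℤ) ^ 2) = 1 := by
    have : μ ^ ((s * t) ^ 2) = 1 := by rw [mul_pow, mul_comm, pow_mul, hμt, one_pow]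
    exact_mod_cast this
  have h3 : ω ^ (((s * t : ℕ) : ℤ) * (n % s)) = 1 := by
    rw [hω.zpow_eq_one_iff_dvd, mul_comm s t]
    exact dvd_mul_right _ _
  rw [h1, h2, h3, one_mul, one_mul, mul_one]

include hs ht hμ hμt hω in
/-- For every shift not divisible by the period, the correlation summand is multiplied by a
nontrivial constant under a suitable translation. -/
theorem exists_translate_milewski_correlation (a : ℤ) (ha : ¬ ((s ^ 2 * t : ℕ) : ℤ) ∣ a) :
    ∃ (d : ℤ) (c : ℂ), c ≠ 1 ∧ ∀ n, milewski s μ ω (n + d + a) * (milewski s μ ω (n + d))⁻¹ =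
      c * (milewski s μ ω (n + a) * (milewski s μ ω n)⁻¹) := by
  have hμ0 := ne_zero_of_sq_isPrimitiveRoot ht hμ
  have hω0 := ne_zero_of_isPrimitiveRoot_mul hs ht hω
  have hF := milewski_ne_zero (s := s) hμ0 hω0
  have hs0 : (s : ℤ) ≠ 0 := by positivity
  have ht0 : (t : ℤ) ≠ 0 := by positivity
  by_cases hsa : (s : ℤ) ∣ a
  · obtain ⟨A, rfl⟩ := hsa
    have hg : ∀ n, milewski s μ ω (n + s * A) * (milewski s μ ω n)⁻¹ =
        μ ^ (2 * (n / s) * A) * μ ^ (A ^ 2) * ω ^ (A * (n % s)) := fun n => by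
      rw [mul_comm (s : ℤ) A, milewski_add_mul hs hμ0 hω0, mul_comm (milewski s μ ω n),
        mul_inv_cancel_right₀ (hF n)]
    simp only [hg]
    by_cases htA : (t : ℤ) ∣ A
    · refine ⟨1, ω ^ A, ?_, fun n => ?_⟩
      · rw [Ne, hω.zpow_eq_one_iff_dvd]
        rintro ⟨k, rfl⟩
        exact ha ⟨k, by push_cast; ring⟩
      · have h1 : ∀ q : ℤ, μ ^ (2 * q * A) = 1 := fun q => by
          rw [mul_assoc, zpow_two_mul_eq_one_iff hμ]
          exact htA.mul_left _
        have h2 : ∀ m : ℤ, ω ^ (A * (m % s)) = ω ^ (A * m) := fun m => by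
          have e : A * m = A * s * (m / s) + A * (m % s) := by
            conv_lhs => rw [← Int.mul_ediv_add_emod m s]
            ring
          have h4 : ω ^ (A * s * (m / s)) = 1 := by
            rw [hω.zpow_eq_one_iff_dvd]
            push_cast
            exact (mul_dvd_mul_right htA _).mul_right _
          rw [e, zpow_add₀ hω0, h4, one_mul]
        rw [h1, h1, h2, h2, mul_add, mul_one, zpow_add₀ hω0]
        ring
    · refine ⟨s, μ ^ (2 * A), ?_, fun n => ?_⟩
      · rwa [Ne, zpow_two_mul_eq_one_iff hμ]
      · have h1 : (n + s) / (s : ℤ) = n / s + 1 := Int.add_ediv_of_dvd_right dvd_rfl |>.trans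
          (by rw [Int.ediv_self hs0])
        have e : 2 * (n / s + 1) * A = 2 * A + 2 * (n / s) * A := by ring
        rw [Int.add_emod_right, h1, e, zpow_add₀ hμ0]
        ring
  · refine ⟨t * s, ω ^ (t * a), ?_, fun n => ?_⟩
    · rw [Ne, hω.zpow_eq_one_iff_dvd]
      push_cast
      rwa [mul_dvd_mul_iff_left ht0]
    · have e : n + t * s + a = n + a + t * s := by ring
      rw [e, milewski_add_period_mul hs ht hμ hμt hω, milewski_add_period_mul hs ht hμ hμt hω,
        mul_add, zpow_add₀ hω0]
      have := zpow_ne_zero (t * n) hω0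
      have := hF n
      field_simp

include hs ht hμ hμt hω in
theorem exists_isBHMatrix_of_roots {v h : ℕ} [NeZero v] (hv : v = s ^ 2 * t) (hh : 0 < h) (hμh : μ ^ h = 1)
    (hωh : ω ^ h = 1) :
    ∃ H : Matrix (ZMod v) (ZMod v) ℂ, IsBHMatrix H h := by
  have hp : Function.Periodic (milewski s μ ω) (v : ℤ) :=
    hv ▸ milewski_periodic hs ht hμ hμt hω
  set f : ZMod v → ℂ := fun x => milewski s μ ω (x.val : ℤ) with hf
  have hcast : ∀ n : ℤ, f n = milewski s μ ω n := fun n => by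
    simp only [hf, ZMod.val_intCast]
    conv_rhs => rw [← Int.emod_add_mul_ediv n (v : ℤ), mul_comm]
    exact (hp.int_mul _ _).symm
  refine ⟨_, isBHMatrix_of_autocorrelation hh f (fun x => milewski_pow_eq_one hμh hωh _) ?_⟩
  intro a ha
  obtain ⟨a, rfl⟩ := ZMod.intCast_surjective a
  rw [Ne, ZMod.intCast_zmod_eq_zero_iff_dvd, hv] at ha
  obtain ⟨d, c, hc, hd⟩ := exists_translate_milewski_correlation hs ht hμ hμt hω a ha
  refine sum_eq_zero_of_translate _ (d : ZMod v) c hc fun x => ?_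
  obtain ⟨n, rfl⟩ := ZMod.intCast_surjective x
  simp only [← Int.cast_add, hcast]
  exact hd n

end milewski

/-- If `h` is divisible by `t`, and by `2 * t` for even `t`, there is an `h`-th root of unity
whose squares generate a Chu sequence of period `t`. -/
theorem exists_chu_root {t h : ℕ} (ht : 0 < t) (h1 : t ∣ h) (h2 : Even t → 2 * t ∣ h) :
    ∃ μ : ℂ, IsPrimitiveRoot (μ ^ 2) t ∧ μ ^ (t ^ 2) = 1 ∧ μ ^ h = 1 := by
  rcases Nat.even_or_odd t with he | ho
  · have hμ := Complex.isPrimitiveRoot_exp (2 * t) (by positivity)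
    refine ⟨_, hμ.pow (by positivity) rfl, ?_, (hμ.pow_eq_one_iff_dvd _).2 (h2 he)⟩
    rw [hμ.pow_eq_one_iff_dvd, sq]
    exact mul_dvd_mul_right he.two_dvd _
  · have hμ := Complex.isPrimitiveRoot_exp t ht.ne'
    refine ⟨_, hμ.pow_of_coprime 2 ?_, ?_, (hμ.pow_eq_one_iff_dvd _).2 h1⟩
    · exact Nat.coprime_two_left.2 ho
    · rw [hμ.pow_eq_one_iff_dvd]
      exact dvd_pow_self _ two_ne_zero

theorem mul_dvd_of_half_padicValNat_le {s t h : ℕ} (hs : 0 < s) (ht : Squarefree t) (hh : 0 < h)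
    (hi : ∀ p : ℕ, p.Prime → p ∣ s ^ 2 * t → (padicValNat p (s ^ 2 * t) + 1) / 2 ≤ padicValNat p h) :
    t * s ∣ h := by
  have ht0 : t ≠ 0 := ht.ne_zero
  rw [← Nat.factorization_prime_le_iff_dvd (by positivity) hh.ne']
  intro p hp
  by_cases hpv : p ∣ s ^ 2 * t
  · have h1 := hi p hp hpv
    simp only [← Nat.factorization_def _ hp] at h1
    rw [Nat.factorization_mul (by positivity) ht0, Nat.factorization_pow] at h1
    rw [Nat.factorization_mul ht0 hs.ne']
    have h2 := ht.natFactorization_le_one p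
    simp only [Finsupp.add_apply, Finsupp.smul_apply, smul_eq_mul] at h1 ⊢
    omega
  · have : ¬ p ∣ t * s := fun hd => hpv (hd.trans ⟨s, by ring⟩)
    rw [Nat.factorization_eq_zero_of_not_dvd this]
    exact Nat.zero_le _

theorem two_mul_dvd_of_even {s t h : ℕ} (ht : Squarefree t) (hts : t * s ∣ h) (he : Even t)
    (hii : (s ^ 2 * t) % 4 = 2 → 2 ≤ padicValNat 2 h) : 2 * t ∣ h := by
  rcases Nat.even_or_odd s with hse | hso
  · exact (mul_comm 2 t ▸ mul_dvd_mul_left t hse.two_dvd).trans hts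
  · obtain ⟨r, rfl⟩ := he.two_dvd
    have hr : Odd r := by
      by_contra hr
      obtain ⟨k, rfl⟩ := (Nat.not_odd_iff_even.1 hr).two_dvd
      have := Nat.isUnit_iff.1 (ht 2 ⟨k, by ring⟩)
      omega
    have h4 : 4 ∣ h := by
      have hmod : (s ^ 2 * (2 * r)) % 4 = 2 := by
        obtain ⟨k, hk⟩ := (hso.pow (n := 2)).mul hr
        have : s ^ 2 * (2 * r) = 2 * (s ^ 2 * r) := by ring
        omega
      exact (pow_dvd_pow 2 (hii hmod)).trans pow_padicValNat_dvd
    have hrh : r ∣ h := (Dvd.intro_left 2 rfl).trans ((Dvd.intro s rfl).trans hts)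
    have hco : Nat.Coprime 4 r := Nat.Coprime.pow_left 2 (Nat.coprime_two_left.2 hr)
    have := hco.mul_dvd_of_dvd_of_dvd h4 hrh
    rwa [← mul_assoc]

/-- Corollary 2.5 of the paper. If `v` and `h` are positive integers with
(i) `ν_p(h) ≥ ⌈ν_p(v)/2⌉` for every prime divisor `p` of `v`, and
(ii) `ν_2(h) ≥ 2` if `v ≡ 2 (mod 4)`, then a circulant `BH(ℤ_v, h)` matrix exists. -/
theorem statement3
    (v h : ℕ) [NeZero v] (hh : 0 < h)
    (hi : ∀ p : ℕ, p.Prime → p ∣ v → (padicValNat p v + 1) / 2 ≤ padicValNat p h)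
    (hii : v % 4 = 2 → 2 ≤ padicValNat 2 h) :
    ∃ H : Matrix (ZMod v) (ZMod v) ℂ, IsBHMatrix H h := by
  obtain ⟨t, s, hv, ht⟩ := Nat.sq_mul_squarefree v
  have hs : 0 < s := by
    rcases Nat.eq_zero_or_pos s with rfl | hs
    · exact absurd (by simp [← hv]) (NeZero.ne v)
    · exact hs
  have ht0 : 0 < t := Nat.pos_of_ne_zero ht.ne_zero
  have hts := mul_dvd_of_half_padicValNat_le hs ht hh (hv ▸ hi)
  obtain ⟨μ, hμ, hμt, hμh⟩ := exists_chu_root ht0 ((Dvd.intro s rfl).trans hts)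
    fun he => two_mul_dvd_of_even ht hts he (hv ▸ hii)
  have hω := Complex.isPrimitiveRoot_exp (t * s) (by positivity)
  exact exists_isBHMatrix_of_roots hs ht0 hμ hμt hω hv.symm hh hμh ((hω.pow_eq_one_iff_dvd _).2 hts)
end

section
/- Let p be a prime and let m be a positive integer not divisible by p. Set ζ = ζ_p (a primitive p-th root of unity) if p is odd, and ζ = ζ_4 (a primitive fourth root of unity) if p = 2. If X ∈ ℤ[ζ_m] satisfies X ≡ 0 (mod 1 − ζ), i.e., (1 − ζ) divides X in the ring ℤ[ζ_{pm}] (respectively ℤ[ζ_{4m}] when p = 2), then X ≡ 0 (mod p), i.e., p divides X in ℤ[ζ_m]. -/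
/-- An algebraic integer of `ℚ(ζ)`, with `ζ` a primitive `n`-th root of unity, lies in `ℤ[ζ]`. -/
theorem mem_int_adjoin_of_isIntegral {n : ℕ} [NeZero n] {ζ x : ℂ} (hζ : IsPrimitiveRoot ζ n)
    (hx : x ∈ IntermediateField.adjoin ℚ ({ζ} : Set ℂ)) (hxint : IsIntegral ℤ x) :
    x ∈ Algebra.adjoin ℤ ({ζ} : Set ℂ) := by
  let K := IntermediateField.adjoin ℚ ({ζ} : Set ℂ)
  have : IsCyclotomicExtension {n} ℚ K := by
    have halg : IsAlgebraic ℚ ζ := (hζ.isIntegral (NeZero.pos n)).tower_top.isAlgebraic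
    change IsCyclotomicExtension {n} ℚ K.toSubalgebra
    rw [IntermediateField.adjoin_simple_toSubalgebra_of_isAlgebraic halg]
    exact hζ.adjoin_isCyclotomicExtension ℚ
  have : NumberField K := IsCyclotomicExtension.numberField {n} ℚ K
  let ζ' : K := ⟨ζ, IntermediateField.mem_adjoin_simple_self ℚ ζ⟩
  have hζ' : IsPrimitiveRoot ζ' n := IsPrimitiveRoot.coe_submonoidClass_iff.mp hζ
  have hcl := IsCyclotomicExtension.Rat.isIntegralClosure_adjoin_singleton hζ'
  let f : K →ₐ[ℤ] ℂ := K.val.restrictScalars ℤ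
  have hintK : IsIntegral ℤ (⟨x, hx⟩ : K) :=
    (isIntegral_algHom_iff f Subtype.val_injective).mp hxint
  obtain ⟨y, hy⟩ := hcl.isIntegral_iff.mp hintK
  have hmem := Subalgebra.mem_map.mpr ⟨y.1, y.2, (rfl : f y.1 = f y.1)⟩
  rw [AlgHom.map_adjoin_singleton] at hmem
  have hxy : f y.1 = x := congrArg f hy
  rwa [hxy] at hmem

/-- If `a ^ p ^ k = a`, then raising to the power `p ^ k` is the identity on `ℤ[a]` modulo `p`. -/
theorem exists_pow_prime_pow_eq_add_of_mem_int_adjoin {R : Type*} [CommRing R] {p : ℕ}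
    (hp : p.Prime) (k : ℕ) {a x : R} (ha : a ^ p ^ k = a)
    (hx : x ∈ Algebra.adjoin ℤ ({a} : Set R)) :
    ∃ z ∈ Algebra.adjoin ℤ ({a} : Set R), x ^ p ^ k = x + p * z := by
  induction hx using Algebra.adjoin_induction with
  | mem x hx =>
    rw [Set.mem_singleton_iff] at hx
    exact ⟨0, zero_mem _, by rw [hx, ha]; ring⟩
  | algebraMap r =>
    have : Fact p.Prime := ⟨hp⟩
    obtain ⟨c, hc⟩ : (p : ℤ) ∣ r ^ p ^ k - r := by
      rw [← ZMod.intCast_zmod_eq_zero_iff_dvd]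
      simp
    refine ⟨algebraMap ℤ R c, Subalgebra.algebraMap_mem _ _, ?_⟩
    have h := congrArg (algebraMap ℤ R) hc
    simp only [map_sub, map_pow, map_mul, map_natCast] at h
    linear_combination h
  | add x y hx hy hx' hy' =>
    obtain ⟨z, hz, hxz⟩ := hx'
    obtain ⟨w, hw, hyw⟩ := hy'
    obtain ⟨r, hr⟩ := exists_add_pow_prime_pow_eq hp
      (⟨x, hx⟩ : Algebra.adjoin ℤ ({a} : Set R)) ⟨y, hy⟩ k
    refine ⟨z + w + _, add_mem (add_mem hz hw) (⟨x, hx⟩ * ⟨y, hy⟩ * r).2, ?_⟩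
    have h := congrArg Subtype.val hr
    push_cast at h ⊢
    linear_combination h + hxz + hyw
  | mul x y hx hy hx' hy' =>
    obtain ⟨z, hz, hxz⟩ := hx'
    obtain ⟨w, hw, hyw⟩ := hy'
    refine ⟨x * w + z * y + p * (z * w), ?_, by rw [mul_pow, hxz, hyw]; ring⟩
    exact add_mem (add_mem (mul_mem hx hw) (mul_mem hz hy))
      (mul_mem (natCast_mem _ p) (mul_mem hz hw))

/-- If `ζ ^ p ^ e = 1` with `ζ` integral, then `(1 - ζ) ^ p ^ e` is `p` times an integral
element. -/
theorem exists_isIntegral_one_sub_pow_prime_pow_eq {R : Type*} [CommRing R] {p : ℕ}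
    (hp : p.Prime) (e : ℕ) {ζ : R} (hζ : ζ ^ p ^ e = 1) :
    ∃ r : R, IsIntegral ℤ r ∧ (1 - ζ) ^ p ^ e = p * r := by
  have hxint : IsIntegral ℤ ζ := .of_pow (pow_pos hp.pos e) (hζ ▸ isIntegral_one)
  let z : integralClosure ℤ R := ⟨ζ, hxint⟩
  obtain ⟨r, hr⟩ := exists_add_pow_prime_pow_eq hp (1 - z) z e
  refine ⟨_, (-((1 - z) * z * r)).2, ?_⟩
  have h := congrArg Subtype.val hr
  have hz : (z : R) = ζ := rfl
  rw [sub_add_cancel, one_pow] at h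
  push_cast at h ⊢
  rw [hz, hζ] at h
  rw [hz]
  linear_combination -h

/-- Lemma 3.2 of the paper. Let `p` be a prime and `m` a positive integer
not divisible by `p`.  Put `ζ = ζ_p` if `p` is odd and `ζ = ζ_4` if `p = 2` (so `ζ = ζ_q` with
`q = p` resp. `q = 4`).  If `X ∈ ℤ[ζ_m]` is divisible by `1 - ζ` in `ℤ[ζ_{qm}]`, then `X` is
divisible by `p` in `ℤ[ζ_m]`. -/
theorem statement4
    (p m : ℕ) (hp : p.Prime) (hm : 0 < m) (hpm : ¬ p ∣ m)
    (q : ℕ) (hq : q = if p = 2 then 4 else p)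
    (ζ ζm : ℂ)
    (hζ : ζ = Complex.exp (2 * Real.pi * Complex.I / q))
    (hζm : ζm = Complex.exp (2 * Real.pi * Complex.I / m))
    (X : ℂ) (hX : X ∈ Algebra.adjoin ℤ ({ζm} : Set ℂ))
    (hdvd : ∃ Y ∈ Algebra.adjoin ℤ
        ({Complex.exp (2 * Real.pi * Complex.I / (q * m : ℕ))} : Set ℂ),
      X = (1 - ζ) * Y) :
    ∃ Z ∈ Algebra.adjoin ℤ ({ζm} : Set ℂ), X = (p : ℂ) * Z := by
  have : NeZero m := ⟨hm.ne'⟩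
  have hq' : ∃ e ≤ 2, q = p ^ e := by
    split_ifs at hq with h2
    · exact ⟨2, le_rfl, by rw [hq, h2]; norm_num⟩
    · exact ⟨1, one_le_two, by rw [hq, pow_one]⟩
  obtain ⟨e, he, rfl⟩ := hq'
  have hq0 : p ^ e ≠ 0 := pow_ne_zero _ hp.ne_zero
  have hζ1 : ζ ^ p ^ e = 1 := hζ ▸ (Complex.isPrimitiveRoot_exp _ hq0).pow_eq_one
  have hζm' : IsPrimitiveRoot ζm m := hζm ▸ Complex.isPrimitiveRoot_exp _ hm.ne'
  obtain ⟨Y, hY, hXY⟩ := hdvd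
  have hYint : IsIntegral ℤ Y := by
    refine adjoin_le_integralClosure (R := ℤ) ?_ hY
    have hqm : p ^ e * m ≠ 0 := mul_ne_zero hq0 hm.ne'
    exact (Complex.isPrimitiveRoot_exp _ hqm).isIntegral hqm.bot_lt
  obtain ⟨r, hr, hζr⟩ := exists_isIntegral_one_sub_pow_prime_pow_eq hp e hζ1
  have hXq : X ^ p ^ e = p * (r * Y ^ p ^ e) := by rw [hXY, mul_pow, hζr]; ring
  have hp0 : (p : ℂ) ≠ 0 := Nat.cast_ne_zero.mpr hp.ne_zero
  have hXK : X ∈ IntermediateField.adjoin ℚ ({ζm} : Set ℂ) := by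
    have hle : Algebra.adjoin ℤ ({ζm} : Set ℂ) ≤
        (IntermediateField.adjoin ℚ ({ζm} : Set ℂ)).toSubalgebra.restrictScalars ℤ :=
      Algebra.adjoin_le (IntermediateField.subset_adjoin ℚ _)
    exact hle hX
  have hV : r * Y ^ p ^ e ∈ Algebra.adjoin ℤ ({ζm} : Set ℂ) := by
    refine mem_int_adjoin_of_isIntegral hζm' ?_ (hr.mul (hYint.pow _))
    rw [← mul_div_cancel_left₀ (r * Y ^ p ^ e) hp0, ← hXq]
    exact div_mem (pow_mem hXK _) (natCast_mem _ p)
  set k := m.totient * 2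
  have hk : p ^ k ≡ 1 [MOD m] := by
    have h := (Nat.ModEq.pow_totient ((hp.coprime_iff_not_dvd).mpr hpm)).pow 2
    rwa [← pow_mul, one_pow] at h
  have hζk : ζm ^ p ^ k = ζm := by
    rw [pow_eq_pow_mod _ hζm'.pow_eq_one, hk, ← pow_eq_pow_mod _ hζm'.pow_eq_one, pow_one]
  obtain ⟨Z, hZ, hXZ⟩ := exists_pow_prime_pow_eq_add_of_mem_int_adjoin hp k hζk hX
  have hle : p ^ e ≤ p ^ k :=
    Nat.pow_le_pow_right hp.pos (he.trans (Nat.le_mul_of_pos_left 2 (Nat.totient_pos.mpr hm)))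
  refine ⟨r * Y ^ p ^ e * X ^ (p ^ k - p ^ e) - Z, sub_mem (mul_mem hV (pow_mem hX _)) hZ, ?_⟩
  have hsplit : X ^ p ^ k = X ^ p ^ e * X ^ (p ^ k - p ^ e) := by
    rw [← pow_add, Nat.add_sub_cancel' hle]
  rw [hXq, hXZ] at hsplit
  linear_combination hsplit
end

section
/- Let p be a prime and let a, h be positive integers. If a BH(ℤ_{p^a}, h) matrix exists, then p divides h. -/
open scoped BigOperators

theorem Ideal.map_eq_self_of_inertia {R : Type*} [CommRing R] [IsDedekindDomain R]
    (σ : R ≃+* R) (x : R)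
    (hσ : ∀ P : Ideal R, P.IsPrime → x ∈ P → ∀ z, σ z - z ∈ P)
    (I : Ideal R) (hI : I ≠ ⊥) (hx : x ∈ I) : I.map (σ : R →+* R) = I := by
  have key : ∀ P : Ideal R, P.IsPrime → x ∈ P → P.map (σ : R →+* R) = P := by
    intro P hP hxP
    apply le_antisymm
    · rw [Ideal.map_le_iff_le_comap]
      intro z hz
      have := P.add_mem (hσ P hP hxP z) hz
      simpa using this
    · intro z hz
      have h1 := hσ P hP hxP (σ.symm z)
      rw [RingEquiv.apply_symm_apply] at h1
      have h2 : σ.symm z ∈ P := by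
        have := P.sub_mem hz h1
        simpa using this
      have := Ideal.mem_map_of_mem (σ : R →+* R) h2
      simpa using this
  have hfac : ∀ P ∈ UniqueFactorizationMonoid.normalizedFactors I,
      P.map (σ : R →+* R) = P := by
    intro P hP
    have hprime := UniqueFactorizationMonoid.prime_of_normalized_factor P hP
    exact key P (Ideal.isPrime_of_prime hprime)
      (Ideal.dvd_iff_le.1 (UniqueFactorizationMonoid.dvd_of_mem_normalizedFactors hP) hx)
  rw [← Ideal.prod_normalizedFactors_eq_self hI]
  have := map_multiset_prod (Ideal.mapHom (σ : R →+* R))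
    (UniqueFactorizationMonoid.normalizedFactors I)
  simp only [Ideal.mapHom_apply] at this
  rw [this]
  congr 1
  conv_rhs => rw [← Multiset.map_id (UniqueFactorizationMonoid.normalizedFactors I)]
  exact Multiset.map_congr rfl hfac

namespace IsCyclotomicExtension

theorem exists_algEquiv_pow {N : ℕ} [NeZero N] (K : Type*) [Field K] [CharZero K]
    [IsCyclotomicExtension {N} ℚ K] {T : ℕ} (hT : T.Coprime N) :
    ∃ σ : K ≃ₐ[ℚ] K, ∀ x : K, x ^ N = 1 → σ x = x ^ T := by
  have hζ := zeta_spec N ℚ K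
  have hμ := hζ.pow_of_coprime T hT
  have hirr := Polynomial.cyclotomic.irreducible_rat (NeZero.pos N)
  refine ⟨fromZetaAut hμ hirr, fun x hx => ?_⟩
  obtain ⟨k, -, rfl⟩ := hζ.eq_pow_of_pow_eq_one hx
  rw [map_pow, fromZetaAut_spec, ← pow_mul, ← pow_mul, mul_comm]

open NumberField

theorem sub_mem_of_isPrime {N p a h s : ℕ} [NeZero N] (hp : p.Prime) (hN : N = h * p ^ a)
    (K : Type*) [Field K] [NumberField K] [IsCyclotomicExtension {N} ℚ K]
    (σ : K ≃ₐ[ℚ] K) (hσ : ∀ x : K, x ^ N = 1 → σ x = x ^ (1 + h * s))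
    (P : Ideal (𝓞 K)) (hP : P.IsPrime) (hpP : (p : 𝓞 K) ∈ P) (z : 𝓞 K) :
    RingOfIntegers.mapRingEquiv (σ : K ≃+* K) z - z ∈ P := by
  have hζ := zeta_spec N ℚ K
  have htop := IsCyclotomicExtension.Rat.adjoin_singleton_eq_top hζ
  have hz : z ∈ Algebra.adjoin ℤ {hζ.toInteger} := by rw [htop]; trivial
  induction hz using Algebra.adjoin_induction with
  | mem x hx =>
    rw [Set.mem_singleton_iff] at hx
    subst hx
    have h1 : RingOfIntegers.mapRingEquiv (σ : K ≃+* K) hζ.toInteger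
        = hζ.toInteger ^ (1 + h * s) := by
      apply RingOfIntegers.ext
      change _ = algebraMap (𝓞 K) K _
      rw [RingOfIntegers.mapRingEquiv_apply, map_pow]
      exact hσ _ hζ.pow_eq_one
    have h2 : (hζ.toInteger ^ (h * s)) ^ p ^ a = 1 := by
      rw [← pow_mul, mul_right_comm, ← hN, pow_mul, hζ.toInteger_isPrimitiveRoot.pow_eq_one,
        one_pow]
    have h3 : hζ.toInteger ^ (h * s) - 1 ∈ P := by
      have := Fact.mk hp
      have : CharP (𝓞 K ⧸ P) p := by
        rw [CharP.charP_iff_prime_eq_zero hp, ← map_natCast (Ideal.Quotient.mk P)]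
        exact Ideal.Quotient.eq_zero_iff_mem.2 hpP
      rw [← Ideal.Quotient.eq_zero_iff_mem]
      apply pow_eq_zero_iff (pow_ne_zero a hp.ne_zero) |>.1
      rw [map_sub, sub_pow_char_pow, ← map_pow, h2, map_one, one_pow, sub_self]
    rw [h1, pow_add, pow_one]
    have := P.mul_mem_left hζ.toInteger h3
    rwa [mul_sub, mul_one] at this
  | algebraMap r => simp
  | add x y _ _ hx hy =>
    rw [map_add, add_sub_add_comm]
    exact P.add_mem hx hy
  | mul x y _ _ hx hy =>
    rw [map_mul]
    have := P.add_mem (P.mul_mem_left (RingOfIntegers.mapRingEquiv (σ : K ≃+* K) x) hy)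
      (P.mul_mem_right y hx)
    rwa [mul_sub, sub_mul, sub_add_sub_cancel] at this

theorem pow_eq_one_of_isOfFinOrder {N : ℕ} [NeZero N] (hN : Even N)
    (K : Type*) [Field K] [NumberField K] [IsCyclotomicExtension {N} ℚ K]
    (w : K) (k : ℕ) (hk : 0 < k) (hw : w ^ k = 1) : w ^ N = 1 := by
  have ht := IsCyclotomicExtension.Rat.torsionOrder_eq (n := N) (K := K)
  rw [if_pos hN] at ht
  have hprim := IsPrimitiveRoot.orderOf w
  have hpos : 0 < orderOf w := orderOf_pos_iff.2 (isOfFinOrder_iff_pow_eq_one.2 ⟨k, hk, hw⟩)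
  have : NeZero (orderOf w) := ⟨hpos.ne'⟩
  have := NumberField.Units.dvd_torsionOrder_of_isPrimitiveRoot hprim
  rw [ht] at this
  exact orderOf_dvd_iff_pow_eq_one.1 this

theorem exists_algEquiv_of_isUnit {N h n : ℕ} [NeZero N] (hN : N = h * n) (hcop : h.Coprime n)
    (K : Type*) [Field K] [CharZero K] [IsCyclotomicExtension {N} ℚ K]
    (t : ZMod n) (ht : IsUnit t) :
    ∃ (σ : K ≃ₐ[ℚ] K) (s : ℕ), (∀ x : K, x ^ N = 1 → σ x = x ^ (1 + h * s)) ∧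
      ((1 + h * s : ℕ) : ZMod n) = t := by
  have hN0 : N ≠ 0 := NeZero.ne N
  have : NeZero n := ⟨by rintro rfl; simp at hN; exact hN0 hN⟩
  obtain ⟨s', hs'⟩ : ∃ s : ZMod n, (h : ZMod n) * s = t - 1 := by
    have hu : IsUnit (h : ZMod n) := (ZMod.isUnit_iff_coprime h n).2 hcop
    obtain ⟨v, hv⟩ := hu.exists_right_inv
    exact ⟨v * (t - 1), by rw [← mul_assoc, hv, one_mul]⟩
  have hT : ((1 + h * s'.val : ℕ) : ZMod n) = t := by
    push_cast
    rw [ZMod.natCast_zmod_val, hs']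
    ring
  have hc : (1 + h * s'.val).Coprime N := by
    rw [hN]
    refine Nat.Coprime.mul_right ?_ ?_
    · simp
    · rw [← ZMod.isUnit_iff_coprime, hT]
      exact ht
  obtain ⟨σ, hσ⟩ := exists_algEquiv_pow K hc
  exact ⟨σ, s'.val, hσ, hT⟩

end IsCyclotomicExtension

theorem sum_mul_sum_inv {n : ℕ} [NeZero n] {K : Type*} [Field K] (α : ZMod n → K)
    (hcorr : ∀ k, ∑ i, α (i + k) * (α i)⁻¹ = if k = 0 then (n : K) else 0)
    (ψ : AddChar (ZMod n) K) :
    (∑ i, α i * ψ i) * (∑ i, (α i)⁻¹ * ψ (-i)) = n := by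
  calc (∑ i, α i * ψ i) * (∑ i, (α i)⁻¹ * ψ (-i))
      = ∑ j, ∑ i, (α i * ψ i) * ((α j)⁻¹ * ψ (-j)) := by
        rw [Finset.sum_mul_sum, Finset.sum_comm]
    _ = ∑ j, ∑ k, (α (j + k) * ψ (j + k)) * ((α j)⁻¹ * ψ (-j)) :=
        Finset.sum_congr rfl fun j _ =>
          (Equiv.sum_comp (Equiv.addLeft j) fun i => (α i * ψ i) * ((α j)⁻¹ * ψ (-j))).symm
    _ = ∑ k, ψ k * ∑ j, α (j + k) * (α j)⁻¹ := by
        rw [Finset.sum_comm]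
        refine Finset.sum_congr rfl fun k _ => ?_
        rw [Finset.mul_sum]
        refine Finset.sum_congr rfl fun j _ => ?_
        have : ψ (j + k) * ψ (-j) = ψ k := by
          rw [← AddChar.map_add_eq_mul]
          congr 1
          ring
        rw [← this]
        ring
    _ = n := by simp [hcorr]

theorem Complex.conj_eq_inv_of_pow_eq_one {z : ℂ} {k : ℕ} (hk : k ≠ 0) (hz : z ^ k = 1) :
    (starRingEnd ℂ) z = z⁻¹ := by
  rw [Complex.inv_def, Complex.normSq_eq_norm_sq, norm_eq_one_of_pow_eq_one hz hk]
  simp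

theorem norm_sum_sq {n h : ℕ} [NeZero n] (hh : h ≠ 0) {K : Type*} [Field K] (α : ZMod n → K)
    (hα : ∀ i, α i ^ h = 1)
    (hcorr : ∀ k, ∑ i, α (i + k) * (α i)⁻¹ = if k = 0 then (n : K) else 0)
    (ψ : AddChar (ZMod n) K) (φ : K →+* ℂ) :
    ‖φ (∑ i, α i * ψ i)‖ ^ 2 = n := by
  have h1 := congrArg φ (sum_mul_sum_inv α hcorr ψ)
  have h2 : φ (∑ i, (α i)⁻¹ * ψ (-i)) = (starRingEnd ℂ) (φ (∑ i, α i * ψ i)) := by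
    rw [map_sum, map_sum, map_sum]
    refine Finset.sum_congr rfl fun i _ => ?_
    rw [map_mul, map_mul, map_mul, map_inv₀, AddChar.map_neg_eq_inv, map_inv₀,
      Complex.conj_eq_inv_of_pow_eq_one hh (by rw [← map_pow, hα, map_one]),
      Complex.conj_eq_inv_of_pow_eq_one (NeZero.ne n)
        (by rw [← map_pow, ← AddChar.map_nsmul_eq_pow]; simp)]
  rw [map_mul, h2, Complex.mul_conj, Complex.normSq_eq_norm_sq, map_natCast] at h1
  exact_mod_cast h1

open NumberField in
theorem exists_isUnit_sum_eq {p a h N : ℕ} [NeZero N] (hp : p.Prime) (hN : N = h * p ^ a)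
    [NeZero (p ^ a)] (heven : Even N)
    (K : Type*) [Field K] [NumberField K] [IsCyclotomicExtension {N} ℚ K]
    (α : ZMod (p ^ a) → K) (hα : ∀ i, α i ^ h = 1)
    (hcorr : ∀ k, ∑ i, α (i + k) * (α i)⁻¹ = if k = 0 then ((p ^ a : ℕ) : K) else 0)
    (ψ : AddChar (ZMod (p ^ a)) K)
    (σ : K ≃ₐ[ℚ] K) (s : ℕ) (hσ : ∀ x : K, x ^ N = 1 → σ x = x ^ (1 + h * s)) :
    ∃ w : K, w ^ N = 1 ∧
      ∑ i, α i * ψ (((1 + h * s : ℕ) : ZMod (p ^ a)) * i) = w * ∑ i, α i * ψ i := by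
  have hh : h ≠ 0 := by rintro rfl; simp at hN; exact NeZero.ne N hN
  have hn : p ^ a ≠ 0 := NeZero.ne _
  have hψn : ∀ i, ψ i ^ p ^ a = 1 := fun i => by
    rw [← AddChar.map_nsmul_eq_pow]
    simp
  have hψ : ∀ i, σ (ψ i) = ψ (((1 + h * s : ℕ) : ZMod (p ^ a)) * i) := fun i => by
    rw [hσ _ (by rw [hN, mul_comm, pow_mul, hψn, one_pow]), ← AddChar.map_nsmul_eq_pow,
      nsmul_eq_mul]
  have hσα : ∀ i, σ (α i) = α i := fun i => by
    rw [hσ _ (by rw [hN, pow_mul, hα, one_pow]), pow_add, pow_one, pow_mul, hα, one_pow, mul_one]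
  set X := ∑ i, α i * ψ i with hX
  have hσX : σ X = ∑ i, α i * ψ (((1 + h * s : ℕ) : ZMod (p ^ a)) * i) := by
    rw [hX, map_sum]
    exact Finset.sum_congr rfl fun i _ => by rw [map_mul, hσα, hψ]
  have hintegral : ∀ (x : K) (k : ℕ), k ≠ 0 → x ^ k = 1 → IsIntegral ℤ x := fun x k hk hx =>
    IsIntegral.of_pow (Nat.pos_of_ne_zero hk) (hx ▸ isIntegral_one)
  have hXint : IsIntegral ℤ X := IsIntegral.sum _ fun i _ =>
    (hintegral _ h hh (hα i)).mul (hintegral _ _ hn (hψn i))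
  have hYint : IsIntegral ℤ (∑ i, (α i)⁻¹ * ψ (-i)) := IsIntegral.sum _ fun i _ =>
    (hintegral _ h hh (by rw [inv_pow, hα, inv_one])).mul (hintegral _ _ hn (hψn _))
  have hXY := sum_mul_sum_inv α hcorr ψ
  rw [← hX] at hXY
  obtain ⟨x, hx⟩ : ∃ x : 𝓞 K, algebraMap (𝓞 K) K x = X := ⟨⟨X, hXint⟩, rfl⟩
  obtain ⟨y, hy⟩ : ∃ y : 𝓞 K, algebraMap (𝓞 K) K y = ∑ i, (α i)⁻¹ * ψ (-i) := ⟨⟨_, hYint⟩, rfl⟩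
  have hxy : x * y = (p : 𝓞 K) ^ a := by
    apply RingOfIntegers.ext
    change algebraMap (𝓞 K) K _ = algebraMap (𝓞 K) K _
    rw [map_mul, hx, hy, hXY]
    simp
  have hx0 : x ≠ 0 := by
    rintro rfl
    rw [zero_mul] at hxy
    exact pow_ne_zero a (Nat.cast_ne_zero.2 hp.ne_zero) hxy.symm
  set τ := RingOfIntegers.mapRingEquiv (σ : K ≃+* K) with hτ
  have hspan : (Ideal.span {x}).map (τ : 𝓞 K →+* 𝓞 K) = Ideal.span {x} := by
    refine Ideal.map_eq_self_of_inertia τ ((p : 𝓞 K) ^ a) (fun P hP hpP z => ?_) _ (by simpa) ?_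
    · exact IsCyclotomicExtension.sub_mem_of_isPrime hp hN K σ hσ P hP
        (hP.mem_of_pow_mem _ hpP) z
    · exact Ideal.mem_span_singleton.2 ⟨y, hxy.symm⟩
  rw [Ideal.map_span, Set.image_singleton, Ideal.span_singleton_eq_span_singleton] at hspan
  obtain ⟨u, hu⟩ := hspan.symm
  have hu' : (u : K) * X = σ X := by
    have := congrArg (fun z : 𝓞 K => (z : K)) hu
    simp only [map_mul, hx] at this
    rw [mul_comm, this, ← hx]
    rfl
  refine ⟨u, ?_, by rw [hu', hσX]⟩
  obtain ⟨k, hk, hk'⟩ := Embeddings.pow_eq_one_of_norm_eq_one K ℂ (x := (u : K))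
    (RingOfIntegers.isIntegral_coe _) (fun φ => by
      have h1 := norm_sum_sq hh α hα hcorr ψ φ
      have h2 := norm_sum_sq hh α hα hcorr ψ (φ.comp (σ : K →+* K))
      rw [← hX] at h1 h2
      have h3 : ‖φ (σ X)‖ ^ 2 = ((p ^ a : ℕ) : ℝ) := h2
      rw [← hu', map_mul, norm_mul, mul_pow, h1] at h3
      have h4 : ((p ^ a : ℕ) : ℝ) ≠ 0 := Nat.cast_ne_zero.2 hn
      have h5 : ‖φ (u : K)‖ ^ 2 = 1 := by
        apply mul_right_cancel₀ h4
        rw [h3, one_mul]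
      exact (pow_eq_one_iff_of_nonneg (norm_nonneg _) two_ne_zero).1 h5)
  exact IsCyclotomicExtension.pow_eq_one_of_isOfFinOrder heven K _ k hk hk'

theorem exists_galois_sum {p a h N : ℕ} [NeZero N] (hp : p.Prime) (hN : N = h * p ^ a)
    [NeZero (p ^ a)] (hcop : h.Coprime (p ^ a)) (heven : Even N)
    (K : Type*) [Field K] [NumberField K] [IsCyclotomicExtension {N} ℚ K]
    (α : ZMod (p ^ a) → K) (hα : ∀ i, α i ^ h = 1)
    (hcorr : ∀ k, ∑ i, α (i + k) * (α i)⁻¹ = if k = 0 then ((p ^ a : ℕ) : K) else 0)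
    (ψ : AddChar (ZMod (p ^ a)) K) (hψs : ∀ x : K, x ^ p ^ a = 1 → ∃ j, ψ j = x)
    (t : ZMod (p ^ a)) (ht : IsUnit t) :
    ∃ σ : K →+* K, (∀ x, x ^ h = 1 → σ x = x) ∧ (∀ i, σ (ψ i) = ψ (t * i)) ∧
      ∃ (ε : K) (j : ZMod (p ^ a)), ε ^ h = 1 ∧
        ∑ i, α i * ψ (t * i) = ε * ψ j * ∑ i, α i * ψ i := by
  obtain ⟨σ, s, hσ, rfl⟩ :=
    IsCyclotomicExtension.exists_algEquiv_of_isUnit hN hcop K t ht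
  have hψn : ∀ i, ψ i ^ p ^ a = 1 := fun i => by
    rw [← AddChar.map_nsmul_eq_pow]
    simp
  refine ⟨(σ : K →+* K), fun x hx => ?_, fun i => ?_, ?_⟩
  · change σ x = x
    rw [hσ _ (by rw [hN, pow_mul, hx, one_pow]), pow_add, pow_one, pow_mul, hx, one_pow, mul_one]
  · change σ (ψ i) = _
    rw [hσ _ (by rw [hN, mul_comm, pow_mul, hψn, one_pow]), ← AddChar.map_nsmul_eq_pow,
      nsmul_eq_mul]
  · obtain ⟨w, hw, hsum⟩ := exists_isUnit_sum_eq hp hN heven K α hα hcorr ψ σ s hσ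
    have hw0 : w ≠ 0 := by
      rintro rfl
      rw [zero_pow (NeZero.ne N)] at hw
      exact zero_ne_one hw
    have hbez : (h : ℤ) * h.gcdA (p ^ a) + ((p ^ a : ℕ) : ℤ) * h.gcdB (p ^ a) = 1 := by
      rw [← Nat.gcd_eq_gcd_ab, hcop]
      rfl
    obtain ⟨j, hj⟩ := hψs ((w ^ h) ^ h.gcdA (p ^ a)) (by
      rw [← zpow_natCast, zpow_comm, zpow_natCast, ← pow_mul, ← hN, hw, one_zpow])
    refine ⟨(w ^ p ^ a) ^ h.gcdB (p ^ a), j, ?_, ?_⟩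
    · rw [← zpow_natCast, zpow_comm, zpow_natCast, ← pow_mul, mul_comm, ← hN, hw, one_zpow]
    · rw [hsum, hj]
      congr 1
      conv_lhs => rw [← zpow_one w, ← hbez, zpow_add₀ hw0, zpow_mul, zpow_mul, zpow_natCast,
        zpow_natCast, mul_comm]

theorem ZMod.exists_mul_of_not_isUnit {p b n : ℕ} (hp : p.Prime) (hn : n = p ^ (b + 1))
    (t : ZMod n) (ht : ¬ IsUnit t) : ∃ l < p ^ b, t = ((p * l : ℕ) : ZMod n) := by
  have : NeZero n := ⟨hn ▸ pow_ne_zero _ hp.ne_zero⟩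
  have h1 : p ∣ t.val := by
    by_contra hd
    apply ht
    have hcop := ((Nat.Prime.coprime_iff_not_dvd hp).2 hd).symm.pow_right (b + 1)
    rw [← hn] at hcop
    rwa [← ZMod.natCast_zmod_val t, ZMod.isUnit_iff_coprime]
  obtain ⟨l, hl⟩ := h1
  refine ⟨l, ?_, by rw [← hl, ZMod.natCast_zmod_val]⟩
  have h2 := ZMod.val_lt t
  rw [hl, hn, pow_succ, mul_comm] at h2
  exact lt_of_mul_lt_mul_right h2 (Nat.zero_le _)

theorem AddChar.eq_of_sum_mul_eq_zero {p b n h : ℕ} [NeZero n] (hp : p.Prime)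
    (hn : n = p ^ (b + 1)) {K : Type*} [Field K] [CharZero K]
    (ψ : AddChar (ZMod n) K) (hψ : ψ.IsPrimitive)
    (hgal : ∀ t : ZMod n, IsUnit t →
      ∃ σ : K →+* K, (∀ x, x ^ h = 1 → σ x = x) ∧ ∀ i, σ (ψ i) = ψ (t * i))
    (c : ZMod n → K)
    (hfix : ∀ σ : K →+* K, (∀ x, x ^ h = 1 → σ x = x) → ∀ i, σ (c i) = c i)
    (hc : ∑ i, c i * ψ i = 0) (i : ZMod n) : c (i + (p ^ b : ℕ)) = c i := by
  set m : ZMod n := ((p ^ b : ℕ) : ZMod n) with hm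
  have hzero : ∀ t : ZMod n, ∑ i, (c (i + m) - c i) * ψ (i * t) = 0 := by
    intro t
    have h1 : ∑ i, c (i + m) * ψ (i * t) = ψ (-(m * t)) * ∑ i, c i * ψ (i * t) := by
      rw [← Equiv.sum_comp (Equiv.subRight m), Finset.mul_sum]
      refine Finset.sum_congr rfl fun x _ => ?_
      rw [Equiv.subRight_apply, sub_add_cancel, sub_mul, sub_eq_add_neg, AddChar.map_add_eq_mul]
      ring
    simp only [sub_mul, Finset.sum_sub_distrib]
    rw [h1, ← sub_one_mul]
    by_cases ht : IsUnit t
    · obtain ⟨σ, hσ, hσψ⟩ := hgal t ht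
      have := congrArg σ hc
      simp only [map_sum, map_mul, map_zero, hσψ, hfix σ hσ] at this
      simp only [mul_comm _ t]
      rw [this, mul_zero]
    · obtain ⟨l, -, rfl⟩ := ZMod.exists_mul_of_not_isUnit hp hn t ht
      have : m * ((p * l : ℕ) : ZMod n) = 0 := by
        rw [hm, ← Nat.cast_mul, ← mul_assoc, ← pow_succ, ← hn]
        simp
      rw [this]
      simp
  have h2 : ∑ t, ψ (-(i * t)) * ∑ k, (c (k + m) - c k) * ψ (k * t) = n * (c (i + m) - c i) := by
    calc _ = ∑ k, (c (k + m) - c k) * ∑ t, ψ (t * (k - i)) := by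
          simp only [Finset.mul_sum]
          rw [Finset.sum_comm]
          refine Finset.sum_congr rfl fun k _ => Finset.sum_congr rfl fun t _ => ?_
          rw [show t * (k - i) = -(i * t) + k * t by ring, AddChar.map_add_eq_mul]
          ring
      _ = _ := by
          simp only [AddChar.sum_mulShift _ hψ, ZMod.card, sub_eq_zero]
          simp [mul_comm]
  simp only [hzero, mul_zero, Finset.sum_const_zero] at h2
  have h3 := (mul_eq_zero.1 h2.symm).resolve_left (Nat.cast_ne_zero.2 (NeZero.ne n))
  exact sub_eq_zero.1 h3

theorem eq_one_of_pow_eq_one_of_coprime {K : Type*} [Monoid K] {x : K} {k l : ℕ}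
    (hkl : k.Coprime l) (hk : x ^ k = 1) (hl : x ^ l = 1) : x = 1 := by
  rw [← orderOf_eq_one_iff, ← Nat.dvd_one, ← hkl]
  exact Nat.dvd_gcd (orderOf_dvd_of_pow_eq_one hk) (orderOf_dvd_of_pow_eq_one hl)

theorem sum_sub_mul_inv_sub_inv {n : ℕ} [NeZero n] {K : Type*} [Field K] (α : ZMod n → K)
    (hcorr : ∀ k, ∑ i, α (i + k) * (α i)⁻¹ = if k = 0 then (n : K) else 0)
    (m : ZMod n) (hm : m ≠ 0) :
    ∑ i, (2 - α (i + m) * (α i)⁻¹ - (α (i + m) * (α i)⁻¹)⁻¹) = 2 * n := by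
  have h1 := hcorr m
  have h2 := hcorr (-m)
  rw [if_neg hm] at h1
  rw [if_neg (neg_ne_zero.2 hm), ← Equiv.sum_comp (Equiv.addRight m)] at h2
  rw [Finset.sum_sub_distrib, Finset.sum_sub_distrib, h1]
  have h3 : ∑ i, (α (i + m) * (α i)⁻¹)⁻¹ = 0 := by
    rw [← h2]
    refine Finset.sum_congr rfl fun i _ => ?_
    simp
  rw [h3]
  simp [mul_comm]

theorem Complex.sub_sub_inv_eq {z : ℂ} {h : ℕ} (hh : h ≠ 0) (hz : z ^ h = 1) :
    2 - z - z⁻¹ = ((2 - 2 * z.re : ℝ) : ℂ) := by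
  rw [← Complex.conj_eq_inv_of_pow_eq_one hh hz, sub_sub, Complex.add_conj]
  push_cast
  ring

theorem Complex.neg_one_lt_re_of_pow_eq_one {z : ℂ} {h : ℕ} (hh : Odd h) (hz : z ^ h = 1) :
    -1 < z.re := by
  have hnorm := norm_eq_one_of_pow_eq_one hz hh.pos.ne'
  have hle := (abs_le.1 (Complex.abs_re_le_norm z)).1
  rw [hnorm] at hle
  refine lt_of_le_of_ne hle fun heq => ?_
  have h1 := Complex.sq_norm z
  rw [hnorm, Complex.normSq_apply, ← heq] at h1
  have him : z.im = 0 := by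
    have : z.im * z.im = 0 := by linarith
    simpa using this
  have : z = -1 := Complex.ext (by simp [← heq]) (by simp [him])
  rw [this, hh.neg_one_pow] at hz
  norm_num at hz

theorem exists_shift_eq_of_galois {p b n h : ℕ} [NeZero n] (hp : p.Prime) (hn : n = p ^ (b + 1))
    (hb : 1 ≤ b) (hb2 : p = 2 → 2 ≤ b) (hcop : h.Coprime p)
    {K : Type*} [Field K] [CharZero K]
    (α : ZMod n → K) (hα : ∀ i, α i ^ h = 1)
    (hcorr : ∀ k, ∑ i, α (i + k) * (α i)⁻¹ = if k = 0 then (n : K) else 0)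
    (ψ : AddChar (ZMod n) K) (hψ : ψ.IsPrimitive)
    (hgal : ∀ t : ZMod n, IsUnit t →
      ∃ σ : K →+* K, (∀ x, x ^ h = 1 → σ x = x) ∧ (∀ i, σ (ψ i) = ψ (t * i)) ∧
        ∃ (ε : K) (j : ZMod n), ε ^ h = 1 ∧
          ∑ i, α i * ψ (t * i) = ε * ψ j * ∑ i, α i * ψ i) :
    ∃ r : ZMod n, ∀ k, IsUnit (r - k) → α (k + (p ^ b : ℕ)) = α k := by
  have hn0 : (n : K) ≠ 0 := Nat.cast_ne_zero.2 (NeZero.ne n)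
  set m : ZMod n := ((p ^ b : ℕ) : ZMod n) with hm
  have hpm : (p : ZMod n) * m = 0 := by
    rw [hm, ← Nat.cast_mul, mul_comm, ← pow_succ, ← hn, ZMod.natCast_self]
  have hmm : m * m = 0 := by
    obtain ⟨c, rfl⟩ := Nat.exists_eq_add_of_le' hb
    have : m = p ^ c * p := by rw [hm, pow_succ]; push_cast; rfl
    nth_rewrite 1 [this]
    rw [mul_assoc, hpm, mul_zero]
  have hu : IsUnit (1 + m) :=
    IsUnit.of_mul_eq_one (1 - m) (by linear_combination -hmm)
  obtain ⟨σ, hσ, hσψ, ε, j, hε, hsum⟩ := hgal (1 + m) hu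
  have hX0 : ∑ i, α i * ψ i ≠ 0 := by
    intro h0
    have := sum_mul_sum_inv α hcorr ψ
    rw [h0, zero_mul] at this
    exact hn0 this.symm
  have hiter : ∀ k : ℕ, ∑ i, α i * ψ ((1 + k * m) * i)
      = ε ^ k * ψ (j * (k + m * (k.choose 2 : ℕ))) * ∑ i, α i * ψ i := by
    intro k
    induction k with
    | zero => simp
    | succ k ih =>
      have h1 := congrArg σ ih
      have h2 : σ (∑ i, α i * ψ i) = ∑ i, α i * ψ ((1 + m) * i) := by
        simp only [map_sum, map_mul, hσψ, hσ _ (hα _)]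
      rw [map_mul, map_mul, map_pow, hσ _ hε, hσψ, h2, hsum] at h1
      simp only [map_sum, map_mul, hσψ, hσ _ (hα _)] at h1
      have h3 : ∀ i, (1 + m) * ((1 + k * m) * i) = (1 + ((k + 1 : ℕ) : ZMod n) * m) * i := by
        intro i
        push_cast
        linear_combination (k : ZMod n) * i * hmm
      simp only [h3] at h1
      rw [h1]
      have h4 : j * (((k + 1 : ℕ) : ZMod n) + m * ((k + 1).choose 2 : ℕ))
          = (1 + m) * (j * (k + m * (k.choose 2 : ℕ))) + j := by
        rw [Nat.choose_succ_succ' k 1, Nat.choose_one_right]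
        push_cast
        linear_combination (-j * (k.choose 2 : ℕ)) * hmm
      rw [h4, AddChar.map_add_eq_mul]
      ring
  have hp1 : ε ^ p * ψ (j * (p + m * (p.choose 2 : ℕ))) = 1 := by
    have h1 := hiter p
    rw [hpm, add_zero] at h1
    simp only [one_mul] at h1
    exact mul_right_cancel₀ hX0 (by rw [one_mul]; exact h1.symm)
  have hcopn : h.Coprime n := hn ▸ hcop.pow_right _
  have hz : j * (p + m * (p.choose 2 : ℕ)) = 0 := by
    have h1 := congrArg (· ^ h) hp1
    simp only [mul_pow, one_pow] at h1
    rw [← pow_mul, mul_comm p h, pow_mul, hε, one_pow, one_mul] at h1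
    apply (AddChar.IsPrimitive.zmod_char_eq_one_iff n hψ _).1
    refine eq_one_of_pow_eq_one_of_coprime hcopn h1 ?_
    rw [← AddChar.map_nsmul_eq_pow]
    simp
  have hε1 : ε = 1 := by
    rw [hz, AddChar.map_zero_eq_one, mul_one] at hp1
    exact eq_one_of_pow_eq_one_of_coprime hcop hε hp1
  have hpj : (p : ZMod n) * j = 0 := by
    rcases hp.eq_two_or_odd' with rfl | hodd
    · obtain ⟨c, rfl⟩ := Nat.exists_eq_add_of_le' (hb2 rfl)
      have hm' : m = 2 * (2 * 2 ^ c) := by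
        rw [hm]
        push_cast
        ring
      have hpm' : (2 : ZMod n) * m = 0 := by exact_mod_cast hpm
      have hz' : j * (2 + m) = 0 := by simpa using hz
      push_cast
      linear_combination (1 - 2 ^ c * 2) * hz' + j * 2 ^ c * hpm' - j * hm'
    · have : (p : ℕ) ∣ p.choose 2 := hp.dvd_choose_self two_ne_zero
        (lt_of_le_of_ne hp.two_le (by rintro rfl; exact absurd hodd (by decide)))
      obtain ⟨c, hc⟩ := this
      rw [hc] at hz
      push_cast at hz
      linear_combination hz - j * c * hpm
  obtain ⟨r, hr⟩ : ∃ r : ZMod n, j = m * r := by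
    have h1 : n ∣ p * j.val := by
      rw [← ZMod.natCast_eq_zero_iff]
      push_cast
      rw [ZMod.natCast_zmod_val, hpj]
    have h2 : p * p ^ b ∣ p * j.val := by rwa [← pow_succ', ← hn]
    obtain ⟨l, hl⟩ := Nat.dvd_of_mul_dvd_mul_left hp.pos h2
    refine ⟨(l : ZMod n), ?_⟩
    rw [← ZMod.natCast_zmod_val j, hl, Nat.cast_mul]
  rw [hε1, hr, one_mul] at hsum
  refine ⟨r, fun k hk => ?_⟩
  have hconst := AddChar.eq_of_sum_mul_eq_zero (h := h) hp hn ψ hψ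
    (fun t ht => by
      obtain ⟨σ, h1, h2, -⟩ := hgal t ht
      exact ⟨σ, h1, h2⟩)
    (fun k => α (k - m * k) - α (k - m * r))
    (fun σ hσ i => by rw [map_sub, hσ _ (hα _), hσ _ (hα _)])
    (by
      simp only [sub_mul, Finset.sum_sub_distrib]
      rw [sub_eq_zero]
      have e1 : ∑ i, α (i - m * i) * ψ i = ∑ i, α i * ψ ((1 + m) * i) := by
        obtain ⟨v, hv⟩ := hu
        rw [← Equiv.sum_comp (Units.mulLeft v)]
        refine Finset.sum_congr rfl fun i _ => ?_
        rw [Units.mulLeft_apply, hv]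
        congr 2
        linear_combination -i * hmm
      have e2 : ∑ i, α (i - m * r) * ψ i = ψ (m * r) * ∑ i, α i * ψ i := by
        rw [← Equiv.sum_comp (Equiv.addRight (m * r)), Finset.mul_sum]
        refine Finset.sum_congr rfl fun i _ => ?_
        rw [Equiv.coe_addRight, add_sub_cancel_right, AddChar.map_add_eq_mul]
        ring
      rw [e1, e2, hsum])
  rw [← hm] at hconst
  have hconst' : ∀ l : ℕ, α (k + l * m - m * k) - α (k + l * m - m * r)
      = α (k - m * k) - α (k - m * r) := by
    intro l
    induction l with
    | zero => simp
    | succ l ih =>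
      rw [← ih]
      have h1 := hconst (k + l * m)
      rw [show k + l * m + m - m * (k + l * m + m) = k + ((l + 1 : ℕ) : ZMod n) * m - m * k by
          push_cast; linear_combination -(l + 1 : ZMod n) * hmm,
        show k + l * m + m - m * r = k + ((l + 1 : ℕ) : ZMod n) * m - m * r by
          push_cast; ring,
        show k + l * m - m * (k + l * m) = k + l * m - m * k by
          linear_combination -(l : ZMod n) * hmm] at h1
      exact h1
  set f : ZMod n → K := fun l => α (k - m * r + l * m) with hf
  set C := α (k - m * k) - α (k - m * r)
  have hstep : ∀ l, f (l + (r - k)) = f l + C := by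
    intro l
    rw [← hconst' l.val, ZMod.natCast_zmod_val]
    simp only [hf]
    rw [show k - m * r + (l + (r - k)) * m = k + l * m - m * k by ring,
      show k - m * r + l * m = k + l * m - m * r by ring]
    ring
  have hsteps : ∀ (s : ℕ) l, f (l + s * (r - k)) = f l + s * C := by
    intro s
    induction s with
    | zero => simp
    | succ s ih =>
      intro l
      rw [show l + ((s + 1 : ℕ) : ZMod n) * (r - k) = (l + s * (r - k)) + (r - k) by
        push_cast; ring, hstep, ih]
      push_cast
      ring
  have hC : C = 0 := by
    have h1 := hsteps p 0
    have h2 : f (0 + p * (r - k)) = f 0 := by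
      simp only [hf]
      congr 1
      linear_combination (r - k) * hpm
    rw [h2] at h1
    have h3 : (p : K) * C = 0 := by linear_combination -h1
    exact (mul_eq_zero.1 h3).resolve_left (Nat.cast_ne_zero.2 hp.ne_zero)
  obtain ⟨v, hv⟩ := hk.exists_left_inv
  have h1 := hsteps v.val r
  rw [ZMod.natCast_zmod_val, hv, hC, mul_zero, add_zero] at h1
  simp only [hf] at h1
  rwa [show k - m * r + (r + 1) * m = k + m by ring,
    show k - m * r + r * m = k by ring] at h1

theorem false_of_galois_of_one_le {p b n h : ℕ} [NeZero n] (hp : p.Prime) (hn : n = p ^ (b + 1))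
    (hb : 1 ≤ b) (hb2 : p = 2 → 2 ≤ b) (hh : h ≠ 0) (hcop : h.Coprime p)
    {K : Type*} [Field K] [CharZero K] (φ : K →+* ℂ)
    (α : ZMod n → K) (hα : ∀ i, α i ^ h = 1)
    (hcorr : ∀ k, ∑ i, α (i + k) * (α i)⁻¹ = if k = 0 then (n : K) else 0)
    (ψ : AddChar (ZMod n) K) (hψ : ψ.IsPrimitive)
    (hgal : ∀ t : ZMod n, IsUnit t →
      ∃ σ : K →+* K, (∀ x, x ^ h = 1 → σ x = x) ∧ (∀ i, σ (ψ i) = ψ (t * i)) ∧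
        ∃ (ε : K) (j : ZMod n), ε ^ h = 1 ∧
          ∑ i, α i * ψ (t * i) = ε * ψ j * ∑ i, α i * ψ i) : False := by
  classical
  obtain ⟨r, hr⟩ := exists_shift_eq_of_galois hp hn hb hb2 hcop α hα hcorr ψ hψ hgal
  set m : ZMod n := ((p ^ b : ℕ) : ZMod n) with hm
  have hm0 : m ≠ 0 := by
    rw [hm, Ne, ZMod.natCast_eq_zero_iff, hn]
    exact fun hd => absurd (Nat.le_of_dvd (pow_pos hp.pos b) hd)
      (not_le.2 (Nat.pow_lt_pow_right hp.one_lt (Nat.lt_succ_self b)))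
  have hα0 : ∀ i, α i ≠ 0 := fun i h0 => by
    have := hα i
    rw [h0, zero_pow hh] at this
    exact zero_ne_one this
  have hsum := congrArg φ (sum_sub_mul_inv_sub_inv α hcorr m hm0)
  set z : ZMod n → ℂ := fun i => φ (α (i + m) * (α i)⁻¹) with hz
  have hzh : ∀ i, z i ^ h = 1 := fun i => by
    simp only [hz]
    rw [← map_pow, mul_pow, inv_pow, hα, hα, inv_one, mul_one, map_one]
  have hsum' : ∑ i, (2 - 2 * (z i).re) = 2 * n := by
    have h1 : ∑ i, (2 - z i - (z i)⁻¹) = 2 * (n : ℂ) := by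
      have h2 : φ 2 = 2 := map_ofNat φ 2
      simpa [hz, h2] using hsum
    simp only [fun i => Complex.sub_sub_inv_eq hh (hzh i)] at h1
    exact_mod_cast h1
  set s : Finset (ZMod n) := Finset.univ.filter fun i => ¬ IsUnit (r - i) with hs
  have hsumS : ∑ i ∈ s, (2 - 2 * (z i).re) = 2 * n := by
    rw [← hsum']
    refine Finset.sum_subset (Finset.subset_univ s) fun i _ hi => ?_
    have hi' : IsUnit (r - i) := by simpa [hs] using hi
    simp [hz, hr i hi', hα0 i]
  have hcard : s.card ≤ p ^ b := by
    have hsub : s ⊆ (Finset.range (p ^ b)).image fun l => r - ((p * l : ℕ) : ZMod n) := by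
      intro i hi
      have hi' : ¬ IsUnit (r - i) := by simpa [hs] using hi
      obtain ⟨l, hl, hl'⟩ := ZMod.exists_mul_of_not_isUnit hp hn _ hi'
      exact Finset.mem_image.2 ⟨l, Finset.mem_range.2 hl, by rw [← hl']; ring⟩
    exact (Finset.card_le_card hsub).trans
      (Finset.card_image_le.trans (Finset.card_range _).le)
  have hcard' : (s.card : ℝ) ≤ (p : ℝ) ^ b := by exact_mod_cast hcard
  have hpb : (0 : ℝ) < (p : ℝ) ^ b := pow_pos (Nat.cast_pos.2 hp.pos) b
  have hnR : (n : ℝ) = (p : ℝ) ^ b * p := by rw [hn, pow_succ]; push_cast; rfl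
  rcases hp.eq_two_or_odd' with rfl | hodd
  · have hodd : Odd h := Nat.Coprime.odd_of_right hcop
    have hne : s.Nonempty := by
      have : Fact (1 < n) := ⟨hn ▸ Nat.one_lt_pow (Nat.succ_ne_zero b) hp.one_lt⟩
      exact ⟨r, by simp [hs]⟩
    have h1 : ∑ i ∈ s, (2 - 2 * (z i).re) < ∑ i ∈ s, (4 : ℝ) :=
      Finset.sum_lt_sum_of_nonempty hne fun i _ => by
        linarith [Complex.neg_one_lt_re_of_pow_eq_one hodd (hzh i)]
    rw [hsumS, Finset.sum_const, nsmul_eq_mul, hnR] at h1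
    push_cast at h1
    push_cast at hcard'
    linarith
  · have h3 : (3 : ℝ) ≤ p := by
      have h2 : p ≠ 2 := by rintro rfl; exact absurd hodd (by decide)
      have := hp.two_le
      exact_mod_cast (by omega : 3 ≤ p)
    have h1 : ∑ i ∈ s, (2 - 2 * (z i).re) ≤ ∑ i ∈ s, (4 : ℝ) :=
      Finset.sum_le_sum fun i _ => by
        have := (abs_le.1 (Complex.abs_re_le_norm (z i))).1
        rw [Complex.norm_eq_one_of_pow_eq_one (hzh i) hh] at this
        linarith
    rw [hsumS, Finset.sum_const, nsmul_eq_mul, hnR] at h1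
    nlinarith

theorem dvd_of_galois_of_prime {p h : ℕ} [Fact p.Prime] (hp2 : p ≠ 2) (hh : h ≠ 0)
    {K : Type*} [Field K] [CharZero K] (φ : K →+* ℂ)
    (α : ZMod p → K) (hα : ∀ i, α i ^ h = 1)
    (hcorr : ∀ k, ∑ i, α (i + k) * (α i)⁻¹ = if k = 0 then (p : K) else 0)
    (ψ : AddChar (ZMod p) K) (hψ : ψ.IsPrimitive)
    (hgal : ∀ t : ZMod p, IsUnit t →
      ∃ σ : K →+* K, (∀ x, x ^ h = 1 → σ x = x) ∧ (∀ i, σ (ψ i) = ψ (t * i)) ∧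
        ∃ (ε : K) (j : ZMod p), ε ^ h = 1 ∧
          ∑ i, α i * ψ (t * i) = ε * ψ j * ∑ i, α i * ψ i) : p ∣ h := by
  have hp : p.Prime := Fact.out
  have hp3 : 3 ≤ p := by have := hp.two_le; omega
  have hnorm : ∀ i, ‖φ (α i)‖ = 1 := fun i =>
    Complex.norm_eq_one_of_pow_eq_one (by rw [← map_pow, hα, map_one]) hh
  have hS : ‖φ (∑ i, α i)‖ ^ 2 = p := by
    simpa using norm_sum_sq hh α hα hcorr 1 φ
  obtain ⟨g, hg⟩ := IsCyclic.exists_generator (α := (ZMod p)ˣ)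
  set t : ZMod p := (g : ZMod p) with ht
  have ht0 : t ≠ 0 := g.ne_zero
  have ht1 : t ≠ 1 := by
    intro h1
    have hg1 : g = 1 := Units.ext h1
    have hcard : Fintype.card (ZMod p)ˣ = 1 := by
      rw [Fintype.card_eq_one_iff]
      refine ⟨1, fun x => ?_⟩
      have := hg x
      rw [hg1, Subgroup.mem_zpowers_iff] at this
      obtain ⟨k, hk⟩ := this
      rw [← hk, one_zpow]
    rw [ZMod.card_units] at hcard
    omega
  obtain ⟨-, -, -, ε, j, hε, hsum⟩ := hgal t g.isUnit
  have hconst := AddChar.eq_of_sum_mul_eq_zero (h := h) (b := 0) hp (by simp) ψ hψ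
    (fun t ht => by
      obtain ⟨σ, h1, h2, -⟩ := hgal t ht
      exact ⟨σ, h1, h2⟩)
    (fun k => α (t⁻¹ * k) - ε * α (k - j))
    (fun σ hσ i => by rw [map_sub, map_mul, hσ _ (hα _), hσ _ (hα _), hσ _ hε])
    (by
      simp only [sub_mul, Finset.sum_sub_distrib]
      rw [sub_eq_zero]
      have e1 : ∑ i, α (t⁻¹ * i) * ψ i = ∑ i, α i * ψ (t * i) := by
        rw [← Equiv.sum_comp (Units.mulLeft g)]
        refine Finset.sum_congr rfl fun i _ => ?_
        rw [Units.mulLeft_apply, ← ht, inv_mul_cancel_left₀ ht0]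
      have e2 : ∑ i, ε * α (i - j) * ψ i = ε * ψ j * ∑ i, α i * ψ i := by
        rw [← Equiv.sum_comp (Equiv.addRight j), Finset.mul_sum]
        refine Finset.sum_congr rfl fun i _ => ?_
        rw [Equiv.coe_addRight, add_sub_cancel_right, AddChar.map_add_eq_mul]
        ring
      rw [e1, e2, hsum])
  have hconst' : ∀ k, α (t⁻¹ * k) - ε * α (k - j) = α (t⁻¹ * 0) - ε * α (0 - j) := by
    have : ∀ l : ℕ, α (t⁻¹ * l) - ε * α (l - j) = α (t⁻¹ * 0) - ε * α (0 - j) := by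
      intro l
      induction l with
      | zero => simp
      | succ l ih =>
        rw [← ih]
        simpa using hconst l
    intro k
    simpa using this k.val
  have ht1' : t - 1 ≠ 0 := sub_ne_zero.2 ht1
  set q : ZMod p := j / (t - 1) with hq
  have hqj : t * q - j = q := by
    rw [hq]
    field_simp
    ring
  have hrel : ∀ x, α (q + x) - ε * α (q + t * x) = (1 - ε) * α q := by
    have h1 : ∀ x, α (q + x) - ε * α (q + t * x) = α (t⁻¹ * 0) - ε * α (0 - j) := by
      intro x
      rw [← hconst' (t * (q + x)), inv_mul_cancel_left₀ ht0]
      congr 3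
      linear_combination -hqj
    intro x
    rw [h1 x, ← h1 0, mul_zero, add_zero]
    ring
  have hε1 : ε = 1 := by
    by_contra hne
    have h1 := Finset.sum_congr rfl fun x (_ : x ∈ (Finset.univ : Finset (ZMod p))) => hrel x
    have e1 : ∑ x, α (q + x) = ∑ i, α i := Equiv.sum_comp (Equiv.addLeft q) α
    have e2 : ∑ x, α (q + t * x) = ∑ i, α i :=
      Equiv.sum_comp ((Units.mulLeft g).trans (Equiv.addLeft q)) α
    rw [Finset.sum_sub_distrib, ← Finset.mul_sum, e1, e2] at h1
    have h2 : ∑ i, α i = p * α q := by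
      apply mul_left_cancel₀ (sub_ne_zero.2 (Ne.symm hne))
      simp only [Finset.sum_const, Finset.card_univ, ZMod.card, nsmul_eq_mul] at h1
      linear_combination h1
    rw [h2, map_mul, norm_mul, hnorm, map_natCast, Complex.norm_natCast, mul_one] at hS
    have h3 : p ^ 2 = p := by exact_mod_cast hS
    nlinarith
  have hmul : ∀ x, α (q + t * x) = α (q + x) := fun x => by
    have := hrel x
    rw [hε1] at this
    linear_combination -this
  have hpow : ∀ k : ℕ, α (q + t ^ k) = α (q + 1) := by
    intro k
    induction k with
    | zero => simp
    | succ k ih => rw [pow_succ', hmul, ih]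
  have hall : ∀ i, i ≠ q → α i = α (q + 1) := by
    intro i hi
    have h0 : i - q ≠ 0 := sub_ne_zero.2 hi
    obtain ⟨k, hk⟩ := (mem_powers_iff_mem_zpowers).2 (hg (Units.mk0 _ h0))
    have hk' : t ^ k = i - q := by
      have := congrArg (fun u : (ZMod p)ˣ => (u : ZMod p)) hk
      simpa using this
    rw [← hpow k, hk', add_sub_cancel]
  have hsumα : ∑ i, α i = α q + (p - 1) * α (q + 1) := by
    rw [← Finset.add_sum_erase _ _ (Finset.mem_univ q),
      Finset.sum_congr rfl fun i hi => hall i (Finset.ne_of_mem_erase hi), Finset.sum_const,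
      Finset.card_erase_of_mem (Finset.mem_univ q), Finset.card_univ, ZMod.card, nsmul_eq_mul,
      Nat.cast_sub hp.one_le, Nat.cast_one]
  have hp_eq : p = 3 := by
    have h1 : ‖φ ((p - 1) * α (q + 1))‖ ≤ ‖φ (∑ i, α i)‖ + ‖φ (α q)‖ := by
      have : φ ((p - 1) * α (q + 1)) = φ (∑ i, α i) - φ (α q) := by
        rw [hsumα, ← map_sub]
        ring_nf
      rw [this]
      exact norm_sub_le _ _
    have h2 : φ ((p : K) - 1) = ((p - 1 : ℝ) : ℂ) := by simp
    have h3 : (3 : ℝ) ≤ p := by exact_mod_cast hp3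
    rw [map_mul, norm_mul, hnorm, hnorm, mul_one, h2, Complex.norm_real, Real.norm_of_nonneg
      (by linarith)] at h1
    have h4 : ((p : ℝ) - 2) ^ 2 ≤ p := by
      rw [← hS]
      rw [← hS] at h1
      refine pow_le_pow_left₀ ?_ ?_ 2 <;> rw [hS] at * <;> linarith
    have h5 : (p : ℝ) < 5 := by nlinarith
    have h6 : p < 5 := by exact_mod_cast h5
    have h7 : p ≠ 4 := by rintro rfl; exact absurd hp (by decide)
    omega
  by_contra hd
  have hcop : h.Coprime p := ((Nat.Prime.coprime_iff_not_dvd hp).2 hd).symm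
  have hα0 : ∀ i, α i ≠ 0 := fun i h0 => by
    have := hα i
    rw [h0, zero_pow hh] at this
    exact zero_ne_one this
  have h1 := sum_mul_sum_inv α hcorr 1
  simp only [AddChar.one_apply, mul_one] at h1
  have hsumα' : ∑ i, (α i)⁻¹ = (α q)⁻¹ + (p - 1) * (α (q + 1))⁻¹ := by
    rw [← Finset.add_sum_erase _ _ (Finset.mem_univ q),
      Finset.sum_congr rfl fun i hi => by rw [hall i (Finset.ne_of_mem_erase hi)],
      Finset.sum_const, Finset.card_erase_of_mem (Finset.mem_univ q), Finset.card_univ, ZMod.card,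
      nsmul_eq_mul, Nat.cast_sub hp.one_le, Nat.cast_one]
  rw [hsumα, hsumα'] at h1
  have hp3K : (p : K) = 3 := by rw [hp_eq]; norm_num
  rw [hp3K] at h1
  have hA := hα0 q
  have hB := hα0 (q + 1)
  field_simp at h1
  have h2 : (α q) ^ 2 + α q * α (q + 1) + α (q + 1) ^ 2 = 0 := by
    have : (2 : K) ≠ 0 := two_ne_zero
    apply mul_left_cancel₀ this
    linear_combination h1
  have h3 : (α q / α (q + 1)) ^ p = 1 := by
    have hpow3 : ∀ x : K, x ^ p = x ^ 3 := fun x => congrArg (x ^ ·) hp_eq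
    rw [hpow3, div_pow, div_eq_one_iff_eq (pow_ne_zero _ hB)]
    linear_combination (α q - α (q + 1)) * h2
  have h4 := eq_one_of_pow_eq_one_of_coprime hcop (by rw [div_pow, hα, hα, div_one]) h3
  rw [div_eq_one_iff_eq hB] at h4
  rw [h4] at h2
  have h5 : (3 : K) * α (q + 1) ^ 2 = 0 := by linear_combination h2
  exact mul_ne_zero three_ne_zero (pow_ne_zero 2 hB) h5

theorem even_of_sum_eq_zero_two {h : ℕ} {K : Type*} [Field K] [CharZero K]
    (α : ZMod 2 → K) (hα : ∀ i, α i ^ h = 1)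
    (hcorr : ∑ i, α (i + 1) * (α i)⁻¹ = 0) : Even h := by
  by_contra hodd
  rw [Nat.not_even_iff_odd] at hodd
  have h0 : ∀ i, α i ≠ 0 := fun i h0 => by
    have := hα i
    rw [h0, zero_pow hodd.pos.ne'] at this
    exact zero_ne_one this
  have hs : α 1 * (α 0)⁻¹ + α 0 * (α 1)⁻¹ = 0 := by
    rw [← hcorr]
    exact (Fin.sum_univ_two (fun i : ZMod 2 => α (i + 1) * (α i)⁻¹)).symm
  have hA := h0 0
  have hB := h0 1
  field_simp at hs
  have h1 : α 0 ^ 2 = -α 1 ^ 2 := by linear_combination hs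
  have h2 := congrArg (· ^ h) h1
  simp only [hodd.neg_pow] at h2
  rw [← pow_mul, ← pow_mul, mul_comm, pow_mul, pow_mul, hα, hα, one_pow] at h2
  norm_num at h2

theorem even_of_sum_eq_zero_four {h : ℕ} {K : Type*} [Field K] [CharZero K]
    (α : ZMod 4 → K) (hα : ∀ i, α i ^ h = 1)
    (hcorr : ∑ i, α (i + 2) * (α i)⁻¹ = 0) : Even h := by
  by_contra hodd
  rw [Nat.not_even_iff_odd] at hodd
  have h0 : ∀ i, α i ≠ 0 := fun i h0 => by
    have := hα i
    rw [h0, zero_pow hodd.pos.ne'] at this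
    exact zero_ne_one this
  have hs : α 2 * (α 0)⁻¹ + α 3 * (α 1)⁻¹ + α 0 * (α 2)⁻¹ + α 1 * (α 3)⁻¹ = 0 := by
    rw [← hcorr]
    exact (Fin.sum_univ_four (fun i : ZMod 4 => α (i + 2) * (α i)⁻¹)).symm
  have hA := h0 0
  have hB := h0 1
  have hC := h0 2
  have hD := h0 3
  have key : ∀ x y : K, x ^ h = 1 → y ^ h = 1 → x ≠ -y := by
    rintro x y hx hy rfl
    rw [hodd.neg_pow, hy] at hx
    norm_num at hx
  field_simp at hs
  have hfac : (α 2 * α 1 - -(α 0 * α 3)) * (α 2 * α 3 - -(α 0 * α 1)) = 0 := by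
    linear_combination hs
  rcases mul_eq_zero.1 hfac with h1 | h1
  · exact key _ _ (by rw [mul_pow, hα, hα, one_mul]) (by rw [mul_pow, hα, hα, one_mul])
      (sub_eq_zero.1 h1)
  · exact key _ _ (by rw [mul_pow, hα, hα, one_mul]) (by rw [mul_pow, hα, hα, one_mul])
      (sub_eq_zero.1 h1)

theorem exists_galois_of_correlation {p b n h : ℕ} [NeZero n] (hp : p.Prime)
    (hn : n = p ^ (b + 1)) (hh : h ≠ 0) (hcop : h.Coprime p) (heven : Even (h * n))
    (a : ZMod n → ℂ) (ha : ∀ i, a i ^ h = 1)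
    (hcorr : ∀ k, ∑ i, a (i + k) * (a i)⁻¹ = if k = 0 then (n : ℂ) else 0) :
    ∃ (K : Type) (_ : Field K) (_ : CharZero K) (_ : K →+* ℂ) (α : ZMod n → K)
      (ψ : AddChar (ZMod n) K), (∀ i, α i ^ h = 1) ∧
      (∀ k, ∑ i, α (i + k) * (α i)⁻¹ = if k = 0 then (n : K) else 0) ∧ ψ.IsPrimitive ∧
      ∀ t : ZMod n, IsUnit t →
        ∃ σ : K →+* K, (∀ x, x ^ h = 1 → σ x = x) ∧ (∀ i, σ (ψ i) = ψ (t * i)) ∧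
          ∃ (ε : K) (j : ZMod n), ε ^ h = 1 ∧
            ∑ i, α i * ψ (t * i) = ε * ψ j * ∑ i, α i * ψ i := by
  have hn0 : n ≠ 0 := NeZero.ne n
  have : NeZero h := ⟨hh⟩
  obtain ⟨N, hN⟩ : ∃ N, N = h * n := ⟨_, rfl⟩
  have : NeZero N := ⟨hN ▸ mul_ne_zero hh hn0⟩
  obtain ⟨K, _, _, _⟩ : ∃ (K : Type) (_ : Field K) (_ : NumberField K),
      IsCyclotomicExtension {N} ℚ K :=
    ⟨CyclotomicField N ℚ, inferInstance, inferInstance,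
      by
        have := CyclotomicField.isCyclotomicExtension N ℚ
        rwa [Subsingleton.elim (CyclotomicField.algebra N ℚ) DivisionRing.toRatAlgebra] at this⟩
  have hζ : IsPrimitiveRoot (IsCyclotomicExtension.zeta N ℚ K) N :=
    IsCyclotomicExtension.zeta_spec N ℚ K
  set ζ := IsCyclotomicExtension.zeta N ℚ K
  obtain ⟨φ⟩ : Nonempty (K →+* ℂ) := inferInstance
  have hζh : IsPrimitiveRoot (ζ ^ n) h := hζ.pow (NeZero.pos N) (by rw [hN, mul_comm])
  have hζn : IsPrimitiveRoot (ζ ^ h) n := hζ.pow (NeZero.pos N) hN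
  have hroot : ∀ i, ∃ x : K, x ^ h = 1 ∧ φ x = a i := fun i => by
    obtain ⟨k, -, hk⟩ := (hζh.map_of_injective φ.injective).eq_pow_of_pow_eq_one (ha i)
    refine ⟨(ζ ^ n) ^ k, ?_, by rw [map_pow, hk]⟩
    rw [← pow_mul, mul_comm, pow_mul, hζh.pow_eq_one, one_pow]
  choose α hα hφ using hroot
  have hαcorr : ∀ k, ∑ i, α (i + k) * (α i)⁻¹ = if k = 0 then (n : K) else 0 := fun k => by
    apply φ.injective
    have := hcorr k
    simp only [← hφ] at this
    rw [map_sum]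
    simp only [map_mul, map_inv₀]
    rw [this]
    split_ifs <;> simp
  refine ⟨K, inferInstance, inferInstance, φ, α, AddChar.zmodChar n hζn.pow_eq_one, hα, hαcorr,
    AddChar.zmodChar_primitive_of_primitive_root n hζn, fun t ht => ?_⟩
  subst hn
  refine exists_galois_sum hp hN (hcop.pow_right _) (hN ▸ heven) K α hα hαcorr _
    (fun x hx => ?_) t ht
  obtain ⟨k, -, hk⟩ := hζn.eq_pow_of_pow_eq_one hx
  exact ⟨k, by rw [AddChar.zmodChar_apply', hk]⟩

theorem dvd_of_correlation {p b n h : ℕ} [NeZero n] (hp : p.Prime) (hn : n = p ^ (b + 1))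
    (hh : h ≠ 0) (a : ZMod n → ℂ) (ha : ∀ i, a i ^ h = 1)
    (hcorr : ∀ k, ∑ i, a (i + k) * (a i)⁻¹ = if k = 0 then (n : ℂ) else 0) : p ∣ h := by
  by_contra hd
  have hcop : h.Coprime p := ((Nat.Prime.coprime_iff_not_dvd hp).2 hd).symm
  by_cases hp2 : p = 2
  · subst hp2
    rw [← even_iff_two_dvd] at hd
    rcases b with _ | _ | b
    · obtain rfl : n = 2 := hn
      exact hd (even_of_sum_eq_zero_two a ha ((hcorr 1).trans (if_neg (by decide))))
    · obtain rfl : n = 4 := hn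
      exact hd (even_of_sum_eq_zero_four a ha ((hcorr 2).trans (if_neg (by decide))))
    · have heven : Even (h * n) := by
        rw [hn, pow_succ]
        exact ((even_two.mul_left _).mul_left _)
      obtain ⟨K, _, _, φ, α, ψ, hα, hαcorr, hψ, hgal⟩ :=
        exists_galois_of_correlation hp hn hh hcop heven a ha hcorr
      exact false_of_galois_of_one_le hp hn (by omega) (by omega) hh hcop φ α hα hαcorr ψ hψ hgal
  · have hcop2 : (2 * h).Coprime p :=
      Nat.Coprime.mul_left ((Nat.coprime_primes Nat.prime_two hp).2 (Ne.symm hp2)) hcop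
    have hh2 : 2 * h ≠ 0 := mul_ne_zero two_ne_zero hh
    obtain ⟨K, _, _, φ, α, ψ, hα, hαcorr, hψ, hgal⟩ :=
      exists_galois_of_correlation hp hn hh2 hcop2 ((even_two.mul_right _).mul_right _) a
        (fun i => by rw [mul_comm, pow_mul, ha, one_pow]) hcorr
    rcases b with _ | b
    · obtain rfl : n = p := by simpa using hn
      have := Fact.mk hp
      exact (Nat.Prime.coprime_iff_not_dvd hp).1 hcop2.symm
        (dvd_of_galois_of_prime hp2 hh2 φ α hα hαcorr ψ hψ hgal)
    · exact false_of_galois_of_one_le hp hn (by omega) (fun h2 => absurd h2 hp2) hh2 hcop2 φ α hα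
        hαcorr ψ hψ hgal

theorem IsBHMatrix.sum_mul_inv {n h : ℕ} [NeZero n] (hh : h ≠ 0)
    {H : Matrix (ZMod n) (ZMod n) ℂ} (hH : IsBHMatrix H h) (k : ZMod n) :
    ∑ i, H (i + k) 0 * (H i 0)⁻¹ = if k = 0 then (n : ℂ) else 0 := by
  obtain ⟨hroot, hinv, hmul⟩ := hH
  have hsub : ∀ g j, H g (-j) = H (j + g) 0 := fun g j => by
    rw [← hinv g (-j) j, neg_add_cancel, add_comm]
  have h1 := congrFun (congrFun hmul k) 0
  rw [Matrix.mul_apply, ← Equiv.sum_comp (Equiv.neg (ZMod n))] at h1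
  simp only [Matrix.conjTranspose_apply, Equiv.neg_apply, hsub, add_zero, Matrix.smul_apply,
    Matrix.one_apply, ZMod.card, smul_eq_mul, mul_ite, mul_one, mul_zero] at h1
  rw [← h1]
  refine Finset.sum_congr rfl fun i _ => ?_
  rw [← Complex.conj_eq_inv_of_pow_eq_one hh (hroot i 0), starRingEnd_apply]

/-- Theorem 3.5 of the paper. Let `p` be a prime and `a, h` positive
integers.  If a `BH(ℤ_{p^a}, h)` matrix exists, then `p` divides `h`. -/
theorem statement7
    (p a h : ℕ) (hp : p.Prime) (ha : 0 < a) (hh : 0 < h)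
    (hex : haveI : NeZero (p ^ a) := ⟨pow_ne_zero a hp.ne_zero⟩
      ∃ H : Matrix (ZMod (p ^ a)) (ZMod (p ^ a)) ℂ, IsBHMatrix H h) :
    p ∣ h := by
  have : NeZero (p ^ a) := ⟨pow_ne_zero a hp.ne_zero⟩
  obtain ⟨H, hH⟩ := hex
  obtain ⟨b, rfl⟩ : ∃ b, a = b + 1 := ⟨a - 1, by omega⟩
  exact dvd_of_correlation hp rfl hh.ne' (fun i => H i 0) (fun i => hH.1 i 0)
    (hH.sum_mul_inv hh.ne')
end
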